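/- arXiv:1309.0482 — 5 statements merged into one kernel-verified Lean document; each statement's English description precedes it below -/
import Mathlib

section
/- Suppose p < n. Then the estimator T̂ = log det Σ̂ − τ_{n,p} satisfies the non-asymptotic risk bound E(T̂ − log det Σ)² ≤ −2 log(1 − p/n) + (10p)/(3n(n−p)). -/
open MeasureTheory ProbabilityTheory Filter Matrix

/-- The digamma function `ψ(x) = d/dx log Γ(x)`. -/
noncomputable def digamma (x : ℝ) : ℝ := deriv (fun y : ℝ => Real.log (Real.Gamma y)) x

/-- The centering constant `τ_{n,p} = ∑_{k=1}^p [ψ((n−k+1)/2) − log(n/2)]`. -/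
noncomputable def tauNP (n p : ℕ) : ℝ :=
  ∑ k ∈ Finset.Icc 1 p, (digamma (((n : ℝ) - k + 1) / 2) - Real.log ((n : ℝ) / 2))

/-- `ν` is the multivariate Gaussian distribution `N_p(m, S)` on `ℝ^p`: it is a probability
measure and the pushforward under any linear functional `x ↦ ⟨l, x⟩` is the univariate
Gaussian with mean `⟨l, m⟩` and variance `lᵀ S l`. -/
def IsMvGaussian {p : ℕ} (m : Fin p → ℝ) (S : Matrix (Fin p) (Fin p) ℝ)
    (ν : Measure (Fin p → ℝ)) : Prop :=
  IsProbabilityMeasure ν ∧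
    ∀ l : Fin p → ℝ,
      ν.map (fun x => ∑ i, l i * x i) =
        gaussianReal (∑ i, l i * m i) (Real.toNNReal (l ⬝ᵥ (S *ᵥ l)))

/-- The sample covariance matrix `Σ̂` based on the `n+1` observations `X 0, …, X n`. -/
noncomputable def sampleCov {n p : ℕ} (X : Fin (n + 1) → Fin p → ℝ) :
    Matrix (Fin p) (Fin p) ℝ :=
  Matrix.of fun i j =>
    (1 / (n : ℝ)) * ∑ k, (X k i - (∑ l, X l i) / (n + 1)) * (X k j - (∑ l, X l j) / (n + 1))

section LogMoments

variable {Ω : Type*} [MeasurableSpace Ω] {P : Measure Ω}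

lemma integrable_exp_of_lintegral_eq {f : Ω → ℝ} (hf : Measurable f) {c : ℝ}
    (h : ∫⁻ ω, ENNReal.ofReal (Real.exp (f ω)) ∂P = ENNReal.ofReal c) :
    Integrable (fun ω => Real.exp (f ω)) P := by
  refine ⟨(Real.measurable_exp.comp hf).aestronglyMeasurable, ?_⟩
  rw [hasFiniteIntegral_iff_ofReal (ae_of_all _ fun ω => (Real.exp_pos _).le), h]
  exact ENNReal.ofReal_lt_top

lemma integral_exp_of_lintegral_eq {f : Ω → ℝ} (hf : Measurable f) {c : ℝ} (hc : 0 ≤ c)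
    (h : ∫⁻ ω, ENNReal.ofReal (Real.exp (f ω)) ∂P = ENNReal.ofReal c) :
    ∫ ω, Real.exp (f ω) ∂P = c := by
  rw [integral_eq_lintegral_of_nonneg_ae (ae_of_all _ fun ω => (Real.exp_pos _).le)
    (Real.measurable_exp.comp hf).aestronglyMeasurable, h, ENNReal.toReal_ofReal hc]

/-- If the exponential moments of `Y` near `0` are `exp (K t)`, the mean and the variance of `Y`
are the first two derivatives of `K` at `0`. -/
lemma mean_variance_of_exp_moments [IsProbabilityMeasure P] {Y : Ω → ℝ} (hY : Measurable Y)
    {K : ℝ → ℝ}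
    (h : ∀ᶠ t in nhds (0 : ℝ), ∫⁻ ω, ENNReal.ofReal (Real.exp (t * Y ω)) ∂P =
      ENNReal.ofReal (Real.exp (K t))) :
    MemLp Y 2 P ∧ AnalyticAt ℝ K 0 ∧ ∫ ω, Y ω ∂P = deriv K 0 ∧
      ∫ ω, (Y ω - ∫ ω', Y ω' ∂P) ^ 2 ∂P = iteratedDeriv 2 K 0 := by
  have hmem : 0 ∈ interior (integrableExpSet Y P) := by
    rw [mem_interior_iff_mem_nhds]
    filter_upwards [h] with t ht
    exact integrable_exp_of_lintegral_eq (hY.const_mul t) ht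
  have hcgf : cgf Y P =ᶠ[nhds 0] K := by
    filter_upwards [h] with t ht
    rw [cgf, mgf, integral_exp_of_lintegral_eq (hY.const_mul t) (Real.exp_pos _).le ht,
      Real.log_exp]
  have hmean : ∫ ω, Y ω ∂P = deriv K 0 := by
    rw [← hcgf.deriv_eq, deriv_cgf_zero hmem]
    simp
  refine ⟨memLp_of_mem_interior_integrableExpSet hmem 2, (analyticAt_cgf hmem).congr hcgf,
    hmean, ?_⟩
  rw [← hcgf.iteratedDeriv_eq, iteratedDeriv_two_cgf_eq_integral hmem, hcgf.deriv_eq, hmean]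
  simp

end LogMoments

section LogGamma

lemma lintegral_exp_mul_log_gammaMeasure {a t : ℝ} (ha : 0 < a) (hat : 0 < a + t) :
    ∫⁻ x, ENNReal.ofReal (Real.exp (t * Real.log x)) ∂(gammaMeasure a 1) =
      ENNReal.ofReal (Real.Gamma (a + t) / Real.Gamma a) := by
  have hga := Real.Gamma_pos_of_pos ha
  have hgat := Real.Gamma_pos_of_pos hat
  have hm : Measurable (gammaPDF a 1) := (measurable_gammaPDFReal a 1).ennreal_ofReal
  have hm' : Measurable (gammaPDF (a + t) 1) := (measurable_gammaPDFReal (a + t) 1).ennreal_ofReal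
  rw [gammaMeasure, lintegral_withDensity_eq_lintegral_mul _ hm (by fun_prop)]
  rw [← mul_one (ENNReal.ofReal _), ← lintegral_gammaPDF_eq_one hat one_pos,
    ← lintegral_const_mul _ hm']
  refine lintegral_congr_ae ?_
  have h0 : ∀ᵐ x : ℝ, x ≠ 0 := by simp [ae_iff]
  filter_upwards [h0] with x hx
  rcases lt_or_gt_of_ne hx with hx | hx
  · simp [gammaPDF_of_neg hx]
  · rw [Pi.mul_apply, gammaPDF_of_nonneg hx.le, gammaPDF_of_nonneg hx.le,
      ← ENNReal.ofReal_mul (by positivity), ← ENNReal.ofReal_mul (by positivity)]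
    congr 1
    rw [mul_comm t, ← Real.rpow_def_of_pos hx, show a + t - 1 = (a - 1) + t by ring,
      Real.rpow_add hx, Real.one_rpow, Real.one_rpow]
    field_simp

lemma gammaMeasure_log_moments {a : ℝ} (ha : 0 < a) :
    MemLp Real.log 2 (gammaMeasure a 1) ∧
      AnalyticAt ℝ (fun y => Real.log (Real.Gamma y)) a ∧
      ∫ x, (Real.log x - ∫ y, Real.log y ∂(gammaMeasure a 1)) ^ 2 ∂(gammaMeasure a 1) =
        iteratedDeriv 2 (fun y => Real.log (Real.Gamma y)) a := by
  have := isProbabilityMeasure_gammaMeasure ha one_pos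
  have h := mean_variance_of_exp_moments (P := gammaMeasure a 1) Real.measurable_log
    (K := fun t => Real.log (Real.Gamma (a + t)) - Real.log (Real.Gamma a)) (by
      filter_upwards [lt_mem_nhds (neg_lt_zero.2 ha)] with t ht
      have hat : 0 < a + t := by linarith
      have hga := Real.Gamma_pos_of_pos ha
      have hgat := Real.Gamma_pos_of_pos hat
      rw [lintegral_exp_mul_log_gammaMeasure ha hat, ← Real.log_div hgat.ne' hga.ne',
        Real.exp_log (by positivity)])
  obtain ⟨h1, h2, -, h4⟩ := h
  have han : AnalyticAt ℝ (fun y => Real.log (Real.Gamma y)) a := by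
    have h5 := h2.add (analyticAt_const (v := Real.log (Real.Gamma a)))
    have h6 := AnalyticAt.comp_of_eq (f := fun y => y - a) h5 (x := a) (by fun_prop) (by simp)
    refine h6.congr (Eventually.of_forall fun y => ?_)
    simp
  refine ⟨h1, han, ?_⟩
  rw [h4, iteratedDeriv_succ, iteratedDeriv_one, iteratedDeriv_succ, iteratedDeriv_one]
  have : deriv (fun t => Real.log (Real.Gamma (a + t)) - Real.log (Real.Gamma a)) =
      fun t => deriv (fun y => Real.log (Real.Gamma y)) (a + t) := by
    ext t
    rw [deriv_sub_const, deriv_comp_const_add (f := fun y => Real.log (Real.Gamma y))]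
  rw [this, deriv_comp_const_add (f := deriv fun y => Real.log (Real.Gamma y)), add_zero]

lemma sq_le_exp_add_exp_neg_sub_two (u : ℝ) : u ^ 2 ≤ Real.exp u + Real.exp (-u) - 2 := by
  have h : u ^ 2 ≤ (2 * Real.sinh (u / 2)) ^ 2 := by
    rcases le_total 0 u with hu | hu
    · have := Real.self_le_sinh_iff.2 (show 0 ≤ u / 2 by linarith)
      nlinarith
    · have := Real.sinh_le_self_iff.2 (show u / 2 ≤ 0 by linarith)
      nlinarith
  have e : (2 * Real.sinh (u / 2)) ^ 2 = Real.exp u + Real.exp (-u) - 2 := by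
    have h1 : Real.exp u = Real.exp (u / 2) ^ 2 := by rw [← Real.exp_nat_mul]; ring_nf
    have h2 : Real.exp (-u) = Real.exp (-(u / 2)) ^ 2 := by rw [← Real.exp_nat_mul]; ring_nf
    have h3 : Real.exp (u / 2) * Real.exp (-(u / 2)) = 1 := by rw [← Real.exp_add]; simp
    rw [Real.sinh_eq, h1, h2]
    linear_combination (-2) * h3
  rwa [e] at h

lemma iteratedDeriv_two_log_Gamma_le_of_one_lt {a : ℝ} (ha : 1 < a) :
    iteratedDeriv 2 (fun y => Real.log (Real.Gamma y)) a ≤ 1 / (a - 1) := by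
  have ha0 : 0 < a := by linarith
  have := isProbabilityMeasure_gammaMeasure ha0 one_pos
  obtain ⟨hL2, -, hvar⟩ := gammaMeasure_log_moments ha0
  rw [← hvar]
  set μ := gammaMeasure a 1
  have hga := Real.Gamma_pos_of_pos ha0
  have hp := lintegral_exp_mul_log_gammaMeasure ha0 (t := 1) (by linarith)
  have hm := lintegral_exp_mul_log_gammaMeasure ha0 (t := -1) (by linarith)
  have hg1 : Real.Gamma (a + 1) / Real.Gamma a = a := by
    rw [Real.Gamma_add_one ha0.ne']; field_simp
  have hg2 : Real.Gamma (a + -1) / Real.Gamma a = 1 / (a - 1) := by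
    have h1 : a - 1 ≠ 0 := by linarith
    have h2 := Real.Gamma_pos_of_pos (show 0 < a - 1 by linarith)
    have h3 := Real.Gamma_add_one h1
    rw [sub_add_cancel] at h3
    rw [h3, ← sub_eq_add_neg]
    field_simp
  rw [hg1] at hp
  rw [hg2] at hm
  have ip := integrable_exp_of_lintegral_eq (by fun_prop) hp
  have im := integrable_exp_of_lintegral_eq (by fun_prop) hm
  have ep := integral_exp_of_lintegral_eq (by fun_prop) ha0.le hp
  have em := integral_exp_of_lintegral_eq (by fun_prop)
    (one_div_nonneg.2 (by linarith)) hm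
  have hv := variance_le_expectation_sq (μ := μ) (X := fun x => Real.log x - Real.log a)
    (by fun_prop)
  rw [variance_sub_const (by fun_prop), variance_eq_integral (by fun_prop)] at hv
  refine hv.trans ?_
  have hL : MemLp (fun x => Real.log x - Real.log a) 2 μ := hL2.sub (memLp_const _)
  calc ∫ x, ((fun x => Real.log x - Real.log a) ^ 2) x ∂μ
      ≤ ∫ x, (a⁻¹ * Real.exp (1 * Real.log x) + a * Real.exp (-1 * Real.log x) - 2) ∂μ := by
        refine integral_mono hL.integrable_sq
          (((ip.const_mul _).add (im.const_mul _)).sub (integrable_const _)) fun x => ?_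
        have h := sq_le_exp_add_exp_neg_sub_two (Real.log x - Real.log a)
        rw [neg_sub, Real.exp_sub, Real.exp_sub (Real.log a), Real.exp_log ha0] at h
        simp only [Pi.pow_apply]
        refine h.trans (le_of_eq ?_)
        rw [one_mul, neg_one_mul, Real.exp_neg]
        ring
    _ = 1 / (a - 1) := by
        have hadd : Integrable (fun x => a⁻¹ * Real.exp (1 * Real.log x) +
            a * Real.exp (-1 * Real.log x)) μ := (ip.const_mul _).add (im.const_mul _)
        rw [integral_sub hadd (integrable_const _),
          integral_add (ip.const_mul _) (im.const_mul _), integral_const_mul, integral_const_mul,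
          ep, em]
        have : a - 1 ≠ 0 := by linarith
        simp
        field_simp
        ring

lemma iteratedDeriv_two_log_Gamma_add_one {a : ℝ} (ha : 0 < a) :
    iteratedDeriv 2 (fun y => Real.log (Real.Gamma y)) (a + 1) =
      iteratedDeriv 2 (fun y => Real.log (Real.Gamma y)) a - 1 / a ^ 2 := by
  have hfun : (fun y => Real.log (Real.Gamma (y + 1))) =ᶠ[nhds a]
      fun y => Real.log y + Real.log (Real.Gamma y) := by
    filter_upwards [lt_mem_nhds ha] with y hy
    rw [Real.Gamma_add_one hy.ne', Real.log_mul hy.ne' (Real.Gamma_pos_of_pos hy).ne']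
  have h := hfun.iteratedDeriv_eq 2
  rw [iteratedDeriv_comp_add_const 2 (fun y => Real.log (Real.Gamma y)) 1] at h
  beta_reduce at h
  rw [h, iteratedDeriv_fun_add (Real.contDiffAt_log.2 ha.ne')
    (gammaMeasure_log_moments ha).2.1.contDiffAt]
  have : iteratedDeriv 2 (fun y => Real.log y) a = -(1 / a ^ 2) := by
    rw [iteratedDeriv_succ, iteratedDeriv_one, Real.deriv_log', deriv_inv]
    simp
  rw [this]
  ring

lemma iteratedDeriv_two_log_Gamma_le {a : ℝ} (ha : 1 / 4 ≤ a) :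
    iteratedDeriv 2 (fun y => Real.log (Real.Gamma y)) a ≤ 1 / a + 5 / (6 * a ^ 2) := by
  set L := iteratedDeriv 2 (fun y => Real.log (Real.Gamma y))
  set F : ℝ → ℝ := fun a => 1 / a + 5 / (6 * a ^ 2)
  have hstep : ∀ b : ℝ, 1 / 4 ≤ b → L b - F b ≤ L (b + 1) - F (b + 1) := by
    intro b hb
    have hb0 : 0 < b := by linarith
    rw [show L (b + 1) = L b - 1 / b ^ 2 from iteratedDeriv_two_log_Gamma_add_one hb0]
    have : 1 / b ^ 2 ≤ F b - F (b + 1) := by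
      have e : F b - F (b + 1) - 1 / b ^ 2 = (4 * b - 1) / (6 * b ^ 2 * (b + 1) ^ 2) := by
        simp only [F]
        field_simp
        ring
      have : 0 ≤ (4 * b - 1) / (6 * b ^ 2 * (b + 1) ^ 2) :=
        div_nonneg (by linarith) (by positivity)
      linarith
    linarith
  have hiter : ∀ N : ℕ, L a - F a ≤ L (a + N) - F (a + N) := by
    intro N
    induction N with
    | zero => simp
    | succ N ih =>
      refine ih.trans ((hstep _ ?_).trans (le_of_eq ?_))
      · have : (0 : ℝ) ≤ N := N.cast_nonneg
        linarith
      · push_cast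
        rw [add_assoc]
  have hlim : Tendsto (fun N : ℕ => 1 / (a + N - 1)) atTop (nhds 0) := by
    have : Tendsto (fun N : ℕ => a + (N : ℝ) - 1) atTop atTop := by
      simp_rw [add_sub_right_comm]
      exact tendsto_atTop_add_const_left _ _ tendsto_natCast_atTop_atTop
    simp_rw [one_div]
    exact this.inv_tendsto_atTop
  have hle : L a - F a ≤ 0 := by
    refine ge_of_tendsto hlim ?_
    filter_upwards [eventually_ge_atTop 1] with N hN
    have hN : (1 : ℝ) ≤ N := by exact_mod_cast hN
    have h1 := iteratedDeriv_two_log_Gamma_le_of_one_lt (a := a + N) (by linarith)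
    have h2 : 0 ≤ F (a + N) := by
      have : 0 < a + N := by linarith
      positivity
    have h3 : L (a + N) ≤ 1 / (a + N - 1) := h1
    linarith [hiter N]
  linarith

lemma sum_trigamma_bound_le (n p : ℕ) (hpn : p < n) :
    ∑ k ∈ Finset.Icc 1 p, (2 / ((n : ℝ) - k + 1) + 10 / (3 * ((n : ℝ) - k + 1) ^ 2)) ≤
      -2 * Real.log (1 - (p : ℝ) / n) + (10 * p) / (3 * n * ((n : ℝ) - p)) := by
  induction p with
  | zero => simp
  | succ p ih =>
    have ih := ih (by omega)
    rw [Finset.sum_Icc_succ_top (by omega)]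
    have hn : (p : ℝ) + 1 < n := by exact_mod_cast hpn
    have hp : (0 : ℝ) ≤ p := p.cast_nonneg
    have hn0 : (0 : ℝ) < n := by linarith
    set d : ℝ := (n : ℝ) - p with hd
    have hd1 : 1 < d := by simp only [hd]; linarith
    have hd0 : 0 < d := by linarith
    have hd1' : 0 < d - 1 := by linarith
    have e1 : (n : ℝ) - ((p + 1 : ℕ) : ℝ) + 1 = d := by push_cast; simp only [hd]; ring
    have e2 : (n : ℝ) - ((p + 1 : ℕ) : ℝ) = d - 1 := by push_cast; simp only [hd]; ring
    have e3 : 1 - ((p + 1 : ℕ) : ℝ) / n = (d - 1) / n := by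
      rw [← e2]; field_simp
    have e4 : 1 - (p : ℝ) / n = d / n := by simp only [hd]; field_simp
    rw [e1, e2, e3, Real.log_div hd1'.ne' hn0.ne']
    rw [e4, Real.log_div hd0.ne' hn0.ne'] at ih
    have hlog : 1 / d ≤ Real.log d - Real.log (d - 1) := by
      have := Real.log_le_sub_one_of_pos (show 0 < (d - 1) / d by positivity)
      rw [Real.log_div hd1'.ne' hd0.ne'] at this
      have e : (d - 1) / d - 1 = -(1 / d) := by field_simp; ring
      linarith
    have e5 : 10 * ((p + 1 : ℕ) : ℝ) / (3 * n * (d - 1)) - 10 * p / (3 * n * d) - 10 / (3 * d ^ 2)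
        = 10 / (3 * d ^ 2 * (d - 1)) := by
      have : (p : ℝ) = n - d := by simp only [hd]; ring
      push_cast
      rw [this]
      field_simp
      ring
    have : 0 ≤ 10 / (3 * d ^ 2 * (d - 1)) := by positivity
    have e6 : 2 / d = 2 * (1 / d) := by ring
    linarith

end LogGamma

section GaussianNorm

variable {E : Type*} [NormedAddCommGroup E] [InnerProductSpace ℝ E] [FiniteDimensional ℝ E]
  [MeasurableSpace E] [BorelSpace E]

open scoped RealInnerProductSpace
open Module

lemma integrable_exp_neg_half_mul_sq_norm :
    Integrable (fun x : E => Real.exp (-(1 / 2) * ‖x‖ ^ 2)) := by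
  have h := GaussianFourier.integrable_cexp_neg_mul_sq_norm_add (V := E) (b := 1 / 2)
    (by norm_num) 0 0
  refine h.norm.congr (ae_of_all _ fun x => ?_)
  simp [Complex.norm_exp]
  norm_cast

lemma stdGaussian_eq_withDensity :
    stdGaussian E = (volume : Measure E).withDensity fun x =>
      ENNReal.ofReal ((2 * Real.pi) ^ (-(finrank ℝ E / 2 : ℝ)) * Real.exp (-(1 / 2) * ‖x‖ ^ 2)) := by
  have hmem := (integrable_exp_neg_half_mul_sq_norm (E := E)).const_mul
    ((2 * Real.pi) ^ (-(finrank ℝ E / 2 : ℝ)))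
  have : IsFiniteMeasure ((volume : Measure E).withDensity fun x =>
      ENNReal.ofReal ((2 * Real.pi) ^ (-(finrank ℝ E / 2 : ℝ)) *
        Real.exp (-(1 / 2) * ‖x‖ ^ 2))) :=
    isFiniteMeasure_withDensity_ofReal hmem.2
  apply Measure.ext_of_charFun (E := E)
  ext s
  rw [charFun_stdGaussian, charFun_apply,
    integral_withDensity_eq_integral_toReal_smul (by fun_prop) (by simp)]
  have hF := GaussianFourier.integral_cexp_neg_mul_sq_norm_add (V := E) (b := 1 / 2) (by norm_num)
    Complex.I s
  have e : ∀ x : E, (ENNReal.ofReal ((2 * Real.pi) ^ (-(finrank ℝ E / 2 : ℝ)) *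
      Real.exp (-(1 / 2) * ‖x‖ ^ 2))).toReal • Complex.exp (⟪x, s⟫ * Complex.I) =
      (((2 * Real.pi) ^ (-(finrank ℝ E / 2 : ℝ)) : ℝ) : ℂ) *
        Complex.exp (-(1 / 2) * ‖x‖ ^ 2 + Complex.I * ⟪s, x⟫) := by
    intro x
    rw [ENNReal.toReal_ofReal (by positivity), Complex.real_smul, Complex.exp_add,
      real_inner_comm]
    push_cast
    rw [mul_comm Complex.I]
    ring
  simp_rw [e]
  rw [integral_const_mul, hF, ← mul_assoc]
  have e2 : (((2 * Real.pi) ^ (-(finrank ℝ E / 2 : ℝ)) : ℝ) : ℂ) *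
      ((Real.pi : ℂ) / (1 / 2)) ^ ((finrank ℝ E : ℂ) / 2) = 1 := by
    have : ((Real.pi : ℂ) / (1 / 2)) ^ ((finrank ℝ E : ℂ) / 2) =
        (((2 * Real.pi) ^ ((finrank ℝ E / 2 : ℝ)) : ℝ) : ℂ) := by
      rw [Complex.ofReal_cpow (by positivity)]
      push_cast
      congr 1
      ring
    rw [this, ← Complex.ofReal_mul, ← Real.rpow_add (by positivity)]
    simp
  rw [e2, one_mul, Complex.I_sq]
  congr 1
  ring

lemma integral_norm_rpow_mul_exp_neg_half_mul_sq_norm [Nontrivial E] {t : ℝ}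
    (ht : 0 < (finrank ℝ E : ℝ) / 2 + t) :
    Integrable (fun x : E => ‖x‖ ^ (2 * t) * Real.exp (-(1 / 2) * ‖x‖ ^ (2 : ℝ))) ∧
    ∫ x : E, ‖x‖ ^ (2 * t) * Real.exp (-(1 / 2) * ‖x‖ ^ (2 : ℝ)) =
      (finrank ℝ E * (volume : Measure E).real (Metric.ball 0 1) *
        (2 ^ ((finrank ℝ E : ℝ) / 2) / 2)) * (2 ^ t * Real.Gamma (finrank ℝ E / 2 + t)) := by
  have hd : 0 < finrank ℝ E := finrank_pos
  have hd' : ((finrank ℝ E - 1 : ℕ) : ℝ) = finrank ℝ E - 1 := by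
    rw [Nat.cast_sub hd, Nat.cast_one]
  have e : Set.EqOn (fun y : ℝ => y ^ (finrank ℝ E - 1 + 2 * t : ℝ) *
        Real.exp (-(1 / 2) * y ^ (2 : ℝ)))
      (fun y : ℝ => y ^ (finrank ℝ E - 1) • (y ^ (2 * t) * Real.exp (-(1 / 2) * y ^ (2 : ℝ))))
      (Set.Ioi 0) := by
    intro y hy
    have hy : 0 < y := hy
    simp only [smul_eq_mul]
    rw [← mul_assoc, ← Real.rpow_natCast y, hd', ← Real.rpow_add hy]
  constructor
  · rw [integrable_fun_norm_addHaar (volume : Measure E)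
      (f := fun y : ℝ => y ^ (2 * t) * Real.exp (-(1 / 2) * y ^ (2 : ℝ)))]
    exact (integrableOn_rpow_mul_exp_neg_mul_rpow (by linarith) two_pos
      (by norm_num)).congr_fun e measurableSet_Ioi
  · rw [integral_fun_norm_addHaar (volume : Measure E)
      (f := fun y : ℝ => y ^ (2 * t) * Real.exp (-(1 / 2) * y ^ (2 : ℝ))),
      ← setIntegral_congr_fun measurableSet_Ioi e,
      integral_rpow_mul_exp_neg_mul_rpow two_pos (by linarith) (by norm_num)]
    have e1 : ((finrank ℝ E : ℝ) - 1 + 2 * t + 1) / 2 = finrank ℝ E / 2 + t := by ring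
    have e2 : -((finrank ℝ E : ℝ) - 1 + 2 * t + 1) / 2 = -(finrank ℝ E / 2 + t) := by ring
    have e3 : ((1 : ℝ) / 2) ^ (-((finrank ℝ E : ℝ) / 2 + t)) =
        2 ^ ((finrank ℝ E : ℝ) / 2) * 2 ^ t := by
      rw [one_div, Real.inv_rpow two_pos.le, Real.rpow_neg two_pos.le, inv_inv,
        Real.rpow_add two_pos]
    rw [e1, e2, e3]
    simp only [nsmul_eq_mul, smul_eq_mul]
    ring

/-- The moment of order `t` of the chi-squared distribution with `d` degrees of freedom. -/
noncomputable def chiSqMoment (d t : ℝ) : ℝ := 2 ^ t * Real.Gamma (d / 2 + t) / Real.Gamma (d / 2)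

lemma chiSqMoment_pos {d t : ℝ} (hd : 0 < d) (ht : 0 < d / 2 + t) : 0 < chiSqMoment d t := by
  have := Real.Gamma_pos_of_pos ht
  have := Real.Gamma_pos_of_pos (half_pos hd)
  rw [chiSqMoment]
  positivity

lemma lintegral_sq_norm_rpow_stdGaussian [Nontrivial E] {t : ℝ}
    (ht : 0 < (finrank ℝ E : ℝ) / 2 + t) :
    ∫⁻ x, ENNReal.ofReal (‖x‖ ^ 2) ^ t ∂(stdGaussian E) =
      ENNReal.ofReal (chiSqMoment (finrank ℝ E) t) := by
  have hd : (0 : ℝ) < finrank ℝ E := by exact_mod_cast finrank_pos (R := ℝ) (M := E)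
  have hd2 : 0 < (finrank ℝ E : ℝ) / 2 + 0 := by linarith
  obtain ⟨hi, hI⟩ := integral_norm_rpow_mul_exp_neg_half_mul_sq_norm (E := E) ht
  obtain ⟨-, hI0⟩ := integral_norm_rpow_mul_exp_neg_half_mul_sq_norm (E := E) hd2
  have hg := Real.Gamma_pos_of_pos (half_pos hd)
  set A : ℝ := (2 * Real.pi) ^ (-(finrank ℝ E / 2 : ℝ)) with hA
  set B : ℝ := finrank ℝ E * (volume : Measure E).real (Metric.ball 0 1) *
        (2 ^ ((finrank ℝ E : ℝ) / 2) / 2) with hB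
  have hA0 : 0 < A := by positivity
  have hAB : A * (B * Real.Gamma (finrank ℝ E / 2)) = 1 := by
    have h := GaussianFourier.integral_rexp_neg_mul_sq_norm (V := E) (b := 1 / 2) (by norm_num)
    simp only [mul_zero, Real.rpow_zero, one_mul, add_zero, Real.rpow_two] at hI0
    rw [← hI0, h, hA, show Real.pi / (1 / 2) = 2 * Real.pi by ring,
      ← Real.rpow_add (by positivity)]
    simp
  have hm : Measurable fun x : E =>
      ENNReal.ofReal (A * Real.exp (-(1 / 2) * ‖x‖ ^ 2)) := by fun_prop
  rw [stdGaussian_eq_withDensity, lintegral_withDensity_eq_lintegral_mul _ hm (by fun_prop)]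
  have e : (fun x : E => ENNReal.ofReal (A * Real.exp (-(1 / 2) * ‖x‖ ^ 2))) *
      (fun x : E => ENNReal.ofReal (‖x‖ ^ 2) ^ t) =ᵐ[volume] fun x =>
        ENNReal.ofReal (A * (‖x‖ ^ (2 * t) * Real.exp (-(1 / 2) * ‖x‖ ^ (2 : ℝ)))) := by
    have h0 : ∀ᵐ x : E, x ≠ 0 := by simp [ae_iff]
    filter_upwards [h0] with x hx
    have hx : 0 < ‖x‖ := norm_pos_iff.2 hx
    rw [Pi.mul_apply, ENNReal.ofReal_rpow_of_pos (by positivity), ← ENNReal.ofReal_mul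
      (by positivity), Real.rpow_mul hx.le]
    congr 1
    simp only [Real.rpow_two]
    ring
  rw [lintegral_congr_ae e, ← ofReal_integral_eq_lintegral_ofReal (hi.const_mul A)
    (ae_of_all _ fun x => by positivity), integral_const_mul, hI]
  congr 1
  rw [chiSqMoment, eq_div_iff hg.ne']
  linear_combination (2 ^ t * Real.Gamma (finrank ℝ E / 2 + t)) * hAB

lemma map_orthogonalProjectionOnto_stdGaussian (K : Submodule ℝ E) :
    (stdGaussian E).map K.orthogonalProjectionOnto = stdGaussian K := by
  have hm : Measurable K.orthogonalProjectionOnto :=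
    K.orthogonalProjectionOnto.continuous.measurable
  have := Measure.isProbabilityMeasure_map (μ := stdGaussian E) hm.aemeasurable
  apply Measure.ext_of_charFun (E := K)
  ext s
  rw [charFun_apply, integral_map hm.aemeasurable (by fun_prop)]
  have e : ∀ x : E, ⟪K.orthogonalProjectionOnto x, s⟫ = ⟪x, (s : E)⟫ := fun x =>
    Submodule.inner_orthogonalProjectionOnto_eq_of_mem_right s x
  simp_rw [e]
  rw [← charFun_apply, charFun_stdGaussian, charFun_stdGaussian]
  rfl

end GaussianNorm

section GramDet

variable {E : Type*} [NormedAddCommGroup E] [InnerProductSpace ℝ E] [FiniteDimensional ℝ E]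

open scoped RealInnerProductSpace
open Module

lemma det_gram_sumElim {ι : Type*} [Fintype ι] [DecidableEq ι] (w : ι → E) (v : E) :
    (gram ℝ (Sum.elim w fun _ : Fin 1 => v)).det = (gram ℝ w).det *
      ‖(Submodule.span ℝ (Set.range w))ᗮ.orthogonalProjectionOnto v‖ ^ 2 := by
  by_cases hw : (gram ℝ w).det = 0
  · rw [hw, zero_mul]
    by_contra h
    have hl := linearIndependent_of_det_gram_ne_zero h
    exact (det_gram_ne_zero_iff_linearIndependent.2
      (hl.comp Sum.inl Sum.inl_injective)) hw
  · set U := Submodule.span ℝ (Set.range w)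
    set z : E := Uᗮ.orthogonalProjectionOnto v
    have hzU : z ∈ Uᗮ := Subtype.property _
    have hvz : v - z ∈ U := by
      have := Uᗮ.sub_starProjection_mem_orthogonal v
      rwa [Submodule.orthogonal_orthogonal] at this
    obtain ⟨c, hc⟩ := (Submodule.mem_span_range_iff_exists_fun ℝ).1 hvz
    have hzw : ∀ i, ⟪w i, z⟫ = 0 := fun i =>
      (Submodule.mem_orthogonal U z).1 hzU _ (Submodule.subset_span ⟨i, rfl⟩)
    have hv : v = ∑ i, c i • w i + z := by rw [hc]; abel
    have hwv : ∀ i, ⟪w i, v⟫ = (gram ℝ w *ᵥ c) i := by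
      intro i
      rw [hv, inner_add_right, hzw, add_zero, inner_sum]
      simp [mulVec, dotProduct, gram_apply, real_inner_smul_right, mul_comm]
    have hvv : ⟪v, v⟫ = c ⬝ᵥ (gram ℝ w *ᵥ c) + ‖z‖ ^ 2 := by
      have h1 : ⟪z, v⟫ = ‖z‖ ^ 2 := by
        rw [hv, inner_add_right, inner_sum, real_inner_self_eq_norm_sq]
        refine add_eq_right.2 (Finset.sum_eq_zero fun i _ => ?_)
        rw [real_inner_comm, real_inner_smul_left, hzw, mul_zero]
      calc ⟪v, v⟫ = ⟪∑ i, c i • w i + z, v⟫ := by rw [← hv]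
        _ = _ := by
          rw [inner_add_left, h1, sum_inner]
          simp [real_inner_smul_left, dotProduct, hwv]
    have hblock : gram ℝ (Sum.elim w fun _ : Fin 1 => v) =
        fromBlocks (gram ℝ w) (of fun i _ => (gram ℝ w *ᵥ c) i)
          (of fun _ i => (gram ℝ w *ᵥ c) i) (of fun _ _ => ⟪v, v⟫) := by
      ext i j
      rcases i with i | i <;> rcases j with j | j <;>
        simp [gram_apply, hwv]
      rw [real_inner_comm, hwv]
    let _ := (gram ℝ w).invertibleOfIsUnitDet (isUnit_iff_ne_zero.2 hw)
    rw [hblock, det_fromBlocks₁₁, det_fin_one, invOf_eq_nonsing_inv]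
    congr 1
    have h1 : (of fun (_ : Fin 1) i => (gram ℝ w *ᵥ c) i) * (gram ℝ w)⁻¹ *
        (of fun i (_ : Fin 1) => (gram ℝ w *ᵥ c) i) = of fun _ _ => (gram ℝ w *ᵥ c) ⬝ᵥ c := by
      have h2 : (gram ℝ w)⁻¹ * (of fun i (_ : Fin 1) => (gram ℝ w *ᵥ c) i) =
          of fun i (_ : Fin 1) => c i := by
        have h3 : (of fun i (_ : Fin 1) => (gram ℝ w *ᵥ c) i) =
            gram ℝ w * of fun i (_ : Fin 1) => c i := by
          ext i j
          simp [mul_apply, mulVec, dotProduct]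
        rw [h3, nonsing_inv_mul_cancel_left _ _ (isUnit_iff_ne_zero.2 hw)]
      rw [Matrix.mul_assoc, h2]
      ext i j
      simp [mul_apply, dotProduct]
    rw [h1]
    simp only [Matrix.sub_apply, of_apply, hvv, dotProduct_comm c, add_sub_cancel_left]
    rfl

lemma det_gram_snoc {k : ℕ} (w : Fin k → E) (v : E) :
    (gram ℝ (Fin.snoc w v : Fin (k + 1) → E)).det = (gram ℝ w).det *
      ‖(Submodule.span ℝ (Set.range w))ᗮ.orthogonalProjectionOnto v‖ ^ 2 := by
  rw [← det_gram_sumElim, ← det_submatrix_equiv_self (finSumFinEquiv (m := k) (n := 1))]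
  congr 1
  have : (Sum.elim w fun _ : Fin 1 => v) =
      fun i => (Fin.snoc w v : Fin (k + 1) → E) (finSumFinEquiv i) := by
    ext i
    rcases i with i | i
    · exact (Fin.snoc_castSucc (α := fun _ => E) v w i).symm
    · rw [Subsingleton.elim i 0]
      exact (Fin.snoc_last (α := fun _ => E) v w).symm
  rw [this]
  rfl

omit [FiniteDimensional ℝ E] in
lemma continuous_det_gram {ι : Type*} [Fintype ι] [DecidableEq ι] :
    Continuous fun w : ι → E => (gram ℝ w).det := by
  refine Continuous.matrix_det (continuous_matrix fun i j => ?_)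
  simp only [gram_apply]
  fun_prop

variable [MeasurableSpace E] [BorelSpace E]

lemma lintegral_det_gram_snoc_rpow {k : ℕ} (w : Fin k → E) {d t : ℝ}
    (hd : (d : ℝ) + k = finrank ℝ E) (hd0 : 0 < d) (ht : 0 < d / 2 + t) :
    ∫⁻ v, ENNReal.ofReal (gram ℝ (Fin.snoc w v : Fin (k + 1) → E)).det ^ t ∂(stdGaussian E) =
      ENNReal.ofReal (gram ℝ w).det ^ t * ENNReal.ofReal (chiSqMoment d t) := by
  have hc := chiSqMoment_pos hd0 ht
  simp_rw [det_gram_snoc]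
  by_cases hw : (gram ℝ w).det = 0
  · simp only [hw, zero_mul, ENNReal.ofReal_zero, lintegral_const, measure_univ, mul_one]
    rcases lt_trichotomy t 0 with h | h | h
    · rw [ENNReal.zero_rpow_of_neg h, ENNReal.top_mul (by simpa using hc)]
    · have hg := Real.Gamma_pos_of_pos (half_pos hd0)
      simp [h, chiSqMoment, div_self hg.ne']
    · rw [ENNReal.zero_rpow_of_pos h, zero_mul]
  · have hdet : 0 ≤ (gram ℝ w).det := (posSemidef_gram ℝ w).det_nonneg
    set U := Submodule.span ℝ (Set.range w) with hU
    have hfr : (finrank ℝ Uᗮ : ℝ) = d := by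
      have h1 : finrank ℝ U = k := by
        rw [hU, finrank_span_eq_card (linearIndependent_of_det_gram_ne_zero hw), Fintype.card_fin]
      have h2 := Submodule.finrank_add_finrank_orthogonal U
      rw [h1] at h2
      have h3 : (k : ℝ) + finrank ℝ Uᗮ = finrank ℝ E := by exact_mod_cast h2
      linarith
    have : Nontrivial Uᗮ := by
      apply nontrivial_of_finrank_pos (R := ℝ)
      rw [← hfr] at hd0
      exact_mod_cast hd0
    simp_rw [ENNReal.ofReal_mul hdet, ENNReal.mul_rpow_of_ne_top ENNReal.ofReal_ne_top
      ENNReal.ofReal_ne_top]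
    have hm : Measurable Uᗮ.orthogonalProjectionOnto :=
      Uᗮ.orthogonalProjectionOnto.continuous.measurable
    rw [lintegral_const_mul _ (by fun_prop), ← hfr, ← lintegral_sq_norm_rpow_stdGaussian
      (by rwa [hfr]), ← map_orthogonalProjectionOnto_stdGaussian, lintegral_map (by fun_prop) hm]

lemma measurable_det_gram_cons (u : E) (p : ℕ) :
    Measurable fun z : Fin p → E => (gram ℝ (Fin.cons u z : Fin (p + 1) → E)).det := by
  refine continuous_det_gram.measurable.comp (measurable_pi_iff.2 fun i => ?_)
  refine Fin.cases ?_ (fun i => ?_) i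
  · simp
  · simpa using measurable_pi_apply i

lemma lintegral_det_gram_cons_rpow (u : E) {n : ℕ} (hn : finrank ℝ E = n + 1) (p : ℕ)
    (hp : p ≤ n) {t : ℝ} (ht : 0 < ((n : ℝ) - p + 1) / 2 + t) :
    ∫⁻ z, ENNReal.ofReal (gram ℝ (Fin.cons u z : Fin (p + 1) → E)).det ^ t
        ∂(Measure.pi fun _ : Fin p => stdGaussian E) =
      ENNReal.ofReal (‖u‖ ^ 2) ^ t *
        ENNReal.ofReal (∏ k ∈ Finset.Icc 1 p, chiSqMoment ((n : ℝ) - k + 1) t) := by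
  induction p with
  | zero =>
    rw [lintegral_unique]
    simp [gram_apply]
  | succ p ih =>
    have hp' : ((p : ℝ) + 1) ≤ n := by exact_mod_cast hp
    have e1 : (n : ℝ) - ((p + 1 : ℕ) : ℝ) + 1 = n - p := by push_cast; ring
    rw [e1] at ht
    have hmeas : ∀ q, Measurable fun z : Fin q → E =>
        ENNReal.ofReal (gram ℝ (Fin.cons u z : Fin (q + 1) → E)).det ^ t :=
      fun q => (measurable_det_gram_cons u q).ennreal_ofReal.pow_const t
    have hmp := (measurePreserving_piFinSuccAbove (α := fun _ : Fin (p + 1) => E)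
      (fun _ => stdGaussian E) (Fin.last p)).symm
    rw [← hmp.lintegral_comp (hmeas (p + 1)), lintegral_prod_symm]
    swap
    · exact ((hmeas (p + 1)).comp (MeasurableEquiv.measurable _)).aemeasurable
    have e2 : ∀ (z : Fin p → E) (v : E),
        (Fin.cons u ((MeasurableEquiv.piFinSuccAbove (fun _ : Fin (p + 1) => E)
          (Fin.last p)).symm (v, z)) : Fin (p + 1 + 1) → E) =
        (Fin.snoc (Fin.cons u z : Fin (p + 1) → E) v : Fin (p + 1 + 1) → E) := by
      intro z v
      rw [← Fin.cons_snoc_eq_snoc_cons]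
      congr 1
      simp [MeasurableEquiv.piFinSuccAbove, Fin.insertNthEquiv]
    simp_rw [e2]
    have e3 : ∀ z : Fin p → E, ∫⁻ v, ENNReal.ofReal
        (gram ℝ (Fin.snoc (Fin.cons u z : Fin (p + 1) → E) v : Fin (p + 1 + 1) → E)).det ^ t
          ∂(stdGaussian E) = ENNReal.ofReal (gram ℝ (Fin.cons u z : Fin (p + 1) → E)).det ^ t *
            ENNReal.ofReal (chiSqMoment ((n : ℝ) - p) t) := by
      intro z
      refine lintegral_det_gram_snoc_rpow _ ?_ (by linarith) ht
      rw [hn]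
      push_cast
      ring
    simp_rw [e3]
    rw [lintegral_mul_const _ (hmeas p), ih (by omega) (by linarith), mul_assoc,
      Finset.prod_Icc_succ_top (by omega), ENNReal.ofReal_mul, e1]
    refine Finset.prod_nonneg fun k hk => ?_
    have hk : (k : ℝ) ≤ p := by exact_mod_cast (Finset.mem_Icc.1 hk).2
    exact (chiSqMoment_pos (by linarith) (by linarith)).le

end GramDet

section GaussianSample

lemma measurePreserving_curry_pi (ι κ : Type*) {X : Type*} [Fintype ι] [Fintype κ]
    [MeasurableSpace X] (μ : Measure X) [IsProbabilityMeasure μ] :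
    MeasurePreserving (MeasurableEquiv.curry ι κ X) (Measure.pi fun _ => μ)
      (Measure.pi fun _ => Measure.pi fun _ => μ) := by
  refine ⟨MeasurableEquiv.measurable _, ?_⟩
  simpa only [Measure.infinitePi_eq_pi] using
    Measure.infinitePi_map_curry (ι := ι) (κ := κ) (fun _ _ => μ)

lemma measurePreserving_flip_pi {ι κ X : Type*} [Fintype ι] [Fintype κ] [MeasurableSpace X]
    (μ : Measure X) [IsProbabilityMeasure μ] :
    MeasurePreserving (fun (z : ι → κ → X) k i => z i k)
      (Measure.pi fun _ => Measure.pi fun _ => μ) (Measure.pi fun _ => Measure.pi fun _ => μ) :=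
  (measurePreserving_curry_pi κ ι μ).comp <|
    (measurePreserving_piCongrLeft (α := fun _ : κ × ι => X) (fun _ => μ)
      (Equiv.prodComm ι κ)).comp (measurePreserving_curry_pi ι κ μ).symm

open scoped MatrixOrder in
lemma IsMvGaussian.eq_map {p : ℕ} {m : Fin p → ℝ} {S : Matrix (Fin p) (Fin p) ℝ}
    {ν : Measure (Fin p → ℝ)} (hν : IsMvGaussian m S ν) (hS : S.PosSemidef) :
    ν = (Measure.pi fun _ : Fin p => gaussianReal 0 1).map fun x => m + CFC.sqrt S *ᵥ x := by
  obtain ⟨hprob, hlaw⟩ := hν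
  have h : ν.map (WithLp.toLp 2) = multivariateGaussian (WithLp.toLp 2 m) S := by
    have := Measure.isProbabilityMeasure_map (μ := ν)
      (f := (WithLp.toLp 2 : (Fin p → ℝ) → EuclideanSpace ℝ (Fin p))) (by fun_prop)
    apply Measure.ext_of_charFun (E := EuclideanSpace ℝ (Fin p))
    ext l
    rw [charFun_multivariateGaussian hS, charFun_apply, integral_map (by fun_prop) (by fun_prop)]
    have h1 := congrArg (fun ρ => charFun ρ 1) (hlaw l)
    simp only [charFun_gaussianReal] at h1
    have hm : Measurable fun x : Fin p → ℝ => ∑ i, l i * x i :=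
      Finset.measurable_sum _ fun i _ => (measurable_pi_apply i).const_mul _
    rw [charFun_apply_real, integral_map hm.aemeasurable (by fun_prop)] at h1
    have h2 : 0 ≤ (l : Fin p → ℝ) ⬝ᵥ S *ᵥ l := by simpa using hS.dotProduct_mulVec_nonneg l
    simp only [Complex.ofReal_one, one_mul, one_pow, mul_one, Real.coe_toNNReal _ h2] at h1
    simpa [PiLp.inner_apply, mul_comm] using h1
  have h3 := congrArg (Measure.map (WithLp.ofLp : EuclideanSpace ℝ (Fin p) → Fin p → ℝ)) h
  rw [multivariateGaussian, ← map_pi_eq_stdGaussian, Measure.map_map (by fun_prop) (by fun_prop),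
    Measure.map_map (by fun_prop) (by fun_prop), Measure.map_map (by fun_prop) (by fun_prop)] at h3
  exact Measure.map_id.symm.trans h3

open scoped MatrixOrder in
lemma IsMvGaussian.exists_pi_eq_map {n p : ℕ} {m : Fin p → ℝ} {S : Matrix (Fin p) (Fin p) ℝ}
    {ν : Measure (Fin p → ℝ)} (hν : IsMvGaussian m S ν) (hS : S.PosSemidef) :
    ∃ A : Matrix (Fin p) (Fin p) ℝ, A.det * A.det = S.det ∧
      (Measure.pi fun _ : Fin (n + 1) => ν) =
        (Measure.pi fun _ : Fin p => stdGaussian (EuclideanSpace ℝ (Fin (n + 1)))).map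
          fun z k => m + A *ᵥ fun i => z i k := by
  refine ⟨CFC.sqrt S, by rw [← det_mul, CFC.sqrt_mul_sqrt_self _ hS.nonneg], ?_⟩
  set γ : ∀ q : ℕ, Measure (Fin q → ℝ) := fun q => Measure.pi fun _ : Fin q => gaussianReal 0 1
    with hγ
  have h1 : (stdGaussian (EuclideanSpace ℝ (Fin (n + 1)))).map WithLp.ofLp = γ (n + 1) := by
    rw [← map_pi_eq_stdGaussian, Measure.map_map (by fun_prop) (by fun_prop)]
    exact Measure.map_id
  have h2 : (Measure.pi fun _ : Fin p => stdGaussian (EuclideanSpace ℝ (Fin (n + 1)))).map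
      (fun z i => WithLp.ofLp (z i)) = Measure.pi fun _ : Fin p => γ (n + 1) := by
    have : IsProbabilityMeasure
        ((stdGaussian (EuclideanSpace ℝ (Fin (n + 1)))).map WithLp.ofLp) := by
      rw [h1]
      infer_instance
    rw [Measure.pi_map_pi (fun _ => by fun_prop), h1]
  have h3 : Measure.pi (fun _ : Fin (n + 1) => ν) = (Measure.pi fun _ : Fin (n + 1) => γ p).map
      fun x k => m + CFC.sqrt S *ᵥ x k := by
    have := hν.1
    have e := hν.eq_map hS
    have : IsProbabilityMeasure ((γ p).map fun x => m + CFC.sqrt S *ᵥ x) := by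
      rwa [← e]
    conv_lhs => rw [e]
    exact (Measure.pi_map_pi (f := fun _ x => m + CFC.sqrt S *ᵥ x) fun _ => by fun_prop).symm
  rw [h3, ← (measurePreserving_flip_pi (ι := Fin p) (κ := Fin (n + 1)) (gaussianReal 0 1)).map_eq,
    ← h2, Measure.map_map (by fun_prop) (by fun_prop), Measure.map_map (by fun_prop) (by fun_prop)]
  rfl

lemma sampleCov_add_mulVec {n p : ℕ} (X : Fin (n + 1) → Fin p → ℝ) (m : Fin p → ℝ)
    (A : Matrix (Fin p) (Fin p) ℝ) :
    sampleCov (fun k => m + A *ᵥ X k) = A * sampleCov X * Aᵀ := by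
  have hs : ∀ Y : Fin (n + 1) → Fin p → ℝ, sampleCov Y = (1 / (n : ℝ)) •
      ((of fun k i => Y k i - (∑ l, Y l i) / ((n : ℝ) + 1))ᵀ *
        of fun k i => Y k i - (∑ l, Y l i) / ((n : ℝ) + 1)) := by
    intro Y
    ext i j
    simp [sampleCov, mul_apply]
  have hc : (of fun k i => (m + A *ᵥ X k) i - (∑ l, (m + A *ᵥ X l) i) / ((n : ℝ) + 1)) =
      (of fun k i => X k i - (∑ l, X l i) / ((n : ℝ) + 1)) * Aᵀ := by
    ext k i
    have hn : (n : ℝ) + 1 ≠ 0 := by positivity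
    have e : ∑ l, ∑ a, A i a * X l a = ∑ a, A i a * ∑ l, X l a := by
      rw [Finset.sum_comm]
      simp_rw [Finset.mul_sum]
    simp only [of_apply, mul_apply, transpose_apply, Pi.add_apply, mulVec, dotProduct,
      Finset.sum_add_distrib, e, Finset.sum_const, Finset.card_univ, Fintype.card_fin,
      nsmul_eq_mul, mul_comm _ (A i _), mul_sub, Finset.sum_sub_distrib, mul_div_assoc',
      ← Finset.sum_div]
    push_cast
    field_simp
    ring
  rw [hs, hs, hc, transpose_mul, transpose_transpose]
  simp only [Matrix.mul_smul, Matrix.smul_mul, Matrix.mul_assoc]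

lemma det_gram_cons_one {n p : ℕ} (hn : 0 < n) (z : Fin p → EuclideanSpace ℝ (Fin (n + 1))) :
    (gram ℝ (Fin.cons (WithLp.toLp 2 fun _ => 1) z :
      Fin (p + 1) → EuclideanSpace ℝ (Fin (n + 1)))).det =
      (n + 1) * ((n : ℝ) ^ p * (sampleCov fun k i => z i k).det) := by
  have hn0 : (n : ℝ) ≠ 0 := by positivity
  have hn1 : (n : ℝ) + 1 ≠ 0 := by positivity
  set u : EuclideanSpace ℝ (Fin (n + 1)) := WithLp.toLp 2 fun _ => 1 with hu
  have e1 : (gram ℝ (Fin.cons u z : Fin (p + 1) → EuclideanSpace ℝ (Fin (n + 1)))).submatrix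
      ((finSumFinEquiv (m := 1) (n := p)).trans (finCongr (add_comm 1 p)))
      ((finSumFinEquiv (m := 1) (n := p)).trans (finCongr (add_comm 1 p))) =
      fromBlocks (of fun _ _ => (n : ℝ) + 1) (of fun _ j => ∑ k, z j k) (of fun i _ => ∑ k, z i k)
        (of fun i j => ∑ k, z i k * z j k) := by
    have h0 : ∀ i : Fin 1, (finCongr (add_comm 1 p)) (Fin.castAdd p i) = 0 := by
      intro i
      ext
      simp
    have hs : ∀ i : Fin p, (finCongr (add_comm 1 p)) (Fin.natAdd 1 i) = i.succ := by
      intro i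
      ext
      simp
    ext i j
    rcases i with i | i <;> rcases j with j | j <;>
      simp [gram_apply, h0, hs, hu, PiLp.inner_apply, mul_comm, EuclideanSpace.real_norm_sq_eq]
  rw [← det_submatrix_equiv_self ((finSumFinEquiv (m := 1) (n := p)).trans
    (finCongr (add_comm 1 p))), e1]
  let _ : Invertible (of fun _ _ => (n : ℝ) + 1 : Matrix (Fin 1) (Fin 1) ℝ) :=
    invertibleOfIsUnitDet _ (by simpa using hn1)
  rw [det_fromBlocks₁₁, det_fin_one, invOf_eq_nonsing_inv]
  congr 1
  have e2 := det_smul (sampleCov fun k i => z i k) (n : ℝ)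
  rw [Fintype.card_fin] at e2
  rw [← e2]
  congr 1
  ext i j
  have e3 : ∑ k, (z i k - (∑ l, z i l) / ((n : ℝ) + 1)) * (z j k - (∑ l, z j l) / ((n : ℝ) + 1)) =
      ∑ k, z i k * z j k - (∑ l, z i l) * (∑ l, z j l) / ((n : ℝ) + 1) := by
    simp only [sub_mul, mul_sub, Finset.sum_sub_distrib, ← Finset.sum_mul, ← Finset.mul_sum,
      Finset.sum_const, Finset.card_univ, Fintype.card_fin, nsmul_eq_mul]
    push_cast
    field_simp
    ring
  have e4 : (of fun _ _ => (n : ℝ) + 1 : Matrix (Fin 1) (Fin 1) ℝ)⁻¹ =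
      of fun _ _ => ((n : ℝ) + 1)⁻¹ := by
    refine inv_eq_left_inv ?_
    ext a b
    rw [Subsingleton.elim a b]
    simp [mul_apply, hn1]
  simp only [sampleCov, Matrix.sub_apply, Matrix.smul_apply, of_apply, e3, e4, mul_apply,
    Finset.univ_unique, Finset.sum_singleton, smul_eq_mul]
  field_simp

end GaussianSample

section LogDetGram

lemma deriv_mul_add_sum_comp_const_add {L : ℝ → ℝ} {ι : Type*} {s : Finset ι} {a : ι → ℝ}
    (h : ∀ k ∈ s, AnalyticAt ℝ L (a k)) (c d : ℝ) :
    deriv (fun t => c * t + ∑ k ∈ s, L (a k + t) - d) 0 = c + ∑ k ∈ s, deriv L (a k) ∧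
      iteratedDeriv 2 (fun t => c * t + ∑ k ∈ s, L (a k + t) - d) 0 =
        ∑ k ∈ s, iteratedDeriv 2 L (a k) := by
  have h1 : ∀ᶠ t in nhds (0 : ℝ), deriv (fun t => c * t + ∑ k ∈ s, L (a k + t) - d) t =
      c + ∑ k ∈ s, deriv L (a k + t) := by
    have h2 : ∀ᶠ t in nhds (0 : ℝ), ∀ k ∈ s, AnalyticAt ℝ L (a k + t) := by
      rw [eventually_all_finset]
      intro k hk
      have hcont : Tendsto (fun t : ℝ => a k + t) (nhds 0) (nhds (a k)) :=
        Continuous.tendsto' (by fun_prop) _ _ (add_zero _)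
      exact hcont.eventually (h k hk).eventually_analyticAt
    filter_upwards [h2] with t ht
    refine HasDerivAt.deriv (HasDerivAt.sub_const d (HasDerivAt.add ?_ ?_))
    · simpa using (hasDerivAt_id t).const_mul c
    · exact HasDerivAt.fun_sum fun k hk =>
        (ht k hk).differentiableAt.hasDerivAt.comp_const_add (a k) t
  refine ⟨by simpa using h1.self_of_nhds, ?_⟩
  rw [iteratedDeriv_succ, iteratedDeriv_one, EventuallyEq.deriv_eq h1]
  refine HasDerivAt.deriv (HasDerivAt.const_add c (HasDerivAt.fun_sum fun k hk => ?_))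
  refine HasDerivAt.comp_const_add (a k) 0 ?_
  rw [add_zero, iteratedDeriv_succ, iteratedDeriv_one]
  exact (h k hk).deriv.differentiableAt.hasDerivAt

variable {E : Type*} [NormedAddCommGroup E] [InnerProductSpace ℝ E] [FiniteDimensional ℝ E]
  [MeasurableSpace E] [BorelSpace E]

open Module

lemma ae_det_gram_cons_pos {u : E} (hu : u ≠ 0) {n p : ℕ} (hn : finrank ℝ E = n + 1) (hp : p < n) :
    ∀ᵐ z ∂(Measure.pi fun _ : Fin p => stdGaussian E),
      0 < (gram ℝ (Fin.cons u z : Fin (p + 1) → E)).det := by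
  have hpn : (p : ℝ) + 1 ≤ n := by exact_mod_cast hp
  have h := lintegral_det_gram_cons_rpow u hn p hp.le (t := -1 / 4) (by linarith)
  have hfin : ∀ᵐ z ∂(Measure.pi fun _ : Fin p => stdGaussian E),
      ENNReal.ofReal (gram ℝ (Fin.cons u z : Fin (p + 1) → E)).det ^ (-1 / 4 : ℝ) < ⊤ := by
    refine ae_lt_top ((measurable_det_gram_cons u p).ennreal_ofReal.pow_const _) ?_
    rw [h, ENNReal.ofReal_rpow_of_pos (by positivity)]
    exact ENNReal.mul_ne_top ENNReal.ofReal_ne_top ENNReal.ofReal_ne_top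
  filter_upwards [hfin] with z hz
  by_contra hneg
  rw [ENNReal.ofReal_of_nonpos (not_lt.1 hneg), ENNReal.zero_rpow_of_neg (by norm_num)] at hz
  exact lt_irrefl _ hz

lemma lintegral_exp_mul_log_det_gram_cons {u : E} (hu : u ≠ 0) {n p : ℕ}
    (hn : finrank ℝ E = n + 1) (hp : p < n) {t : ℝ} (ht : 0 < ((n : ℝ) - p + 1) / 2 + t) :
    ∫⁻ z, ENNReal.ofReal (Real.exp (t * Real.log
        (gram ℝ (Fin.cons u z : Fin (p + 1) → E)).det))
        ∂(Measure.pi fun _ : Fin p => stdGaussian E) =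
      ENNReal.ofReal (Real.exp ((Real.log (‖u‖ ^ 2) + p * Real.log 2) * t +
        ∑ k ∈ Finset.Icc 1 p, Real.log (Real.Gamma (((n : ℝ) - k + 1) / 2 + t)) -
        ∑ k ∈ Finset.Icc 1 p, Real.log (Real.Gamma (((n : ℝ) - k + 1) / 2)))) := by
  have hpn : (p : ℝ) + 1 ≤ n := by exact_mod_cast hp
  have hu2 : 0 < ‖u‖ ^ 2 := by positivity
  have e1 : (fun z => ENNReal.ofReal (Real.exp (t * Real.log
      (gram ℝ (Fin.cons u z : Fin (p + 1) → E)).det))) =ᵐ[Measure.pi fun _ : Fin p => stdGaussian E]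
      fun z => ENNReal.ofReal (gram ℝ (Fin.cons u z : Fin (p + 1) → E)).det ^ t := by
    filter_upwards [ae_det_gram_cons_pos hu hn hp] with z hz
    rw [ENNReal.ofReal_rpow_of_pos hz, Real.rpow_def_of_pos hz, mul_comm]
  rw [lintegral_congr_ae e1, lintegral_det_gram_cons_rpow u hn p hp.le ht,
    ENNReal.ofReal_rpow_of_pos hu2, ← ENNReal.ofReal_mul (by positivity)]
  congr 1
  have e2 : ∏ k ∈ Finset.Icc 1 p, chiSqMoment ((n : ℝ) - k + 1) t =
      Real.exp (∑ k ∈ Finset.Icc 1 p, (Real.log 2 * t +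
        Real.log (Real.Gamma (((n : ℝ) - k + 1) / 2 + t)) -
        Real.log (Real.Gamma (((n : ℝ) - k + 1) / 2)))) := by
    rw [Real.exp_sum]
    refine Finset.prod_congr rfl fun k hk => ?_
    have hk : (k : ℝ) ≤ p := by exact_mod_cast (Finset.mem_Icc.1 hk).2
    rw [Real.exp_sub, Real.exp_add, Real.exp_log (Real.Gamma_pos_of_pos (by linarith)),
      Real.exp_log (Real.Gamma_pos_of_pos (by linarith)), ← Real.rpow_def_of_pos two_pos,
      chiSqMoment]
  rw [e2, Real.rpow_def_of_pos hu2, ← Real.exp_add]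
  simp only [Finset.sum_sub_distrib, Finset.sum_add_distrib, Finset.sum_const, Nat.card_Icc,
    Nat.add_sub_cancel, nsmul_eq_mul]
  congr 1
  ring

lemma mean_variance_log_det_gram_cons {u : E} (hu : u ≠ 0) {n p : ℕ}
    (hn : finrank ℝ E = n + 1) (hp : p < n) :
    ∫ z, Real.log (gram ℝ (Fin.cons u z : Fin (p + 1) → E)).det
        ∂(Measure.pi fun _ : Fin p => stdGaussian E) =
      Real.log (‖u‖ ^ 2) + p * Real.log 2 +
        ∑ k ∈ Finset.Icc 1 p, deriv (fun y => Real.log (Real.Gamma y)) (((n : ℝ) - k + 1) / 2) ∧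
    ∫ z, (Real.log (gram ℝ (Fin.cons u z : Fin (p + 1) → E)).det -
        ∫ z', Real.log (gram ℝ (Fin.cons u z' : Fin (p + 1) → E)).det
          ∂(Measure.pi fun _ : Fin p => stdGaussian E)) ^ 2
        ∂(Measure.pi fun _ : Fin p => stdGaussian E) =
      ∑ k ∈ Finset.Icc 1 p,
        iteratedDeriv 2 (fun y => Real.log (Real.Gamma y)) (((n : ℝ) - k + 1) / 2) := by
  have hpn : (p : ℝ) + 1 ≤ n := by exact_mod_cast hp
  have hexp := (lt_mem_nhds (show -(1 / 2 : ℝ) < 0 by norm_num)).mono fun t ht =>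
    lintegral_exp_mul_log_det_gram_cons hu hn hp (t := t) (by linarith)
  obtain ⟨-, -, hmean, hvar⟩ := mean_variance_of_exp_moments
    (measurable_det_gram_cons u p).log hexp
  obtain ⟨hd1, hd2⟩ := deriv_mul_add_sum_comp_const_add (L := fun y => Real.log (Real.Gamma y))
    (s := Finset.Icc 1 p) (a := fun k : ℕ => ((n : ℝ) - k + 1) / 2)
    (fun k hk => (gammaMeasure_log_moments (by
      have : (k : ℝ) ≤ p := by exact_mod_cast (Finset.mem_Icc.1 hk).2
      linarith)).2.1) (Real.log (‖u‖ ^ 2) + p * Real.log 2)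
    (∑ k ∈ Finset.Icc 1 p, Real.log (Real.Gamma (((n : ℝ) - k + 1) / 2)))
  exact ⟨hmean.trans hd1, hvar.trans hd2⟩

end LogDetGram

lemma measurable_det_sampleCov {n p : ℕ} :
    Measurable fun X : Fin (n + 1) → Fin p → ℝ => (sampleCov X).det := by
  refine (Continuous.matrix_det (continuous_matrix fun i j => ?_)).measurable
  simp only [sampleCov, of_apply]
  fun_prop

/-- **Non-asymptotic upper bound** (Theorem 3.1): for `p < n`, the estimator
`T̂ = log det Σ̂ − τ_{n,p}` satisfies
`E(T̂ − log det Σ)² ≤ −2 log(1 − p/n) + (10 p)/(3 n (n − p))`. -/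
theorem risk_upper_bound
    (n p : ℕ) (hp1 : 1 ≤ p) (hpn : p < n)
    (m : Fin p → ℝ)
    (S : Matrix (Fin p) (Fin p) ℝ) (hS : S.PosDef)
    (ν : Measure (Fin p → ℝ)) (hν : IsMvGaussian m S ν) :
    (∫ X, (Real.log (sampleCov X).det - tauNP n p - Real.log S.det) ^ 2
        ∂(Measure.pi fun _ : Fin (n + 1) => ν)) ≤
      -2 * Real.log (1 - (p : ℝ) / n) + (10 * p) / (3 * n * ((n : ℝ) - p)) := by
  have hn : 0 < n := by omega
  have hn0 : (0 : ℝ) < n := by exact_mod_cast hn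
  have hpn' : (p : ℝ) + 1 ≤ n := by exact_mod_cast hpn
  set u : EuclideanSpace ℝ (Fin (n + 1)) := WithLp.toLp 2 fun _ => 1 with hu
  have hu2 : ‖u‖ ^ 2 = n + 1 := by simp [hu, EuclideanSpace.real_norm_sq_eq]
  have hu0 : u ≠ 0 := by
    intro h
    rw [h, norm_zero] at hu2
    linarith
  have hfr : Module.finrank ℝ (EuclideanSpace ℝ (Fin (n + 1))) = n + 1 := by simp
  obtain ⟨hmean, hvar⟩ := mean_variance_log_det_gram_cons hu0 hfr hpn
  obtain ⟨A, hA, hmap⟩ := hν.exists_pi_eq_map (n := n) hS.posSemidef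
  rw [hmap, integral_map (Measurable.aemeasurable (by fun_prop))
    (((measurable_det_sampleCov.log.sub_const _).sub_const _).pow_const 2).aestronglyMeasurable]
  have hτ : tauNP n p = ∑ k ∈ Finset.Icc 1 p,
      deriv (fun y => Real.log (Real.Gamma y)) (((n : ℝ) - k + 1) / 2) +
      p * Real.log 2 - p * Real.log n := by
    simp only [tauNP, digamma, Finset.sum_sub_distrib, Finset.sum_const, Nat.card_Icc,
      Nat.add_sub_cancel, nsmul_eq_mul, Real.log_div hn0.ne' two_ne_zero]
    ring
  have hcongr : ∀ᵐ z ∂(Measure.pi fun _ : Fin p => stdGaussian (EuclideanSpace ℝ (Fin (n + 1)))),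
      (Real.log (sampleCov fun k => m + A *ᵥ fun i => z i k).det - tauNP n p -
        Real.log S.det) ^ 2 =
      (Real.log (gram ℝ (Fin.cons u z :
        Fin (p + 1) → EuclideanSpace ℝ (Fin (n + 1)))).det -
        ∫ z', Real.log (gram ℝ (Fin.cons u z' :
          Fin (p + 1) → EuclideanSpace ℝ (Fin (n + 1)))).det
          ∂(Measure.pi fun _ : Fin p => stdGaussian (EuclideanSpace ℝ (Fin (n + 1))))) ^ 2 := by
    filter_upwards [ae_det_gram_cons_pos hu0 hfr hpn] with z hz
    rw [hmean, hu2]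
    rw [det_gram_cons_one hn] at hz ⊢
    have hdet : (sampleCov fun k i => z i k).det ≠ 0 := by
      rintro h
      simp [h] at hz
    have hS0 : A.det * A.det ≠ 0 := hA ▸ hS.det_pos.ne'
    rw [sampleCov_add_mulVec (fun k i => z i k), det_mul, det_mul, det_transpose,
      mul_right_comm, Real.log_mul hS0 hdet, hA, Real.log_mul (by positivity) (by positivity),
      Real.log_mul (by positivity) hdet, Real.log_pow, hτ]
    ring
  rw [integral_congr_ae hcongr, hvar]
  refine le_trans (Finset.sum_le_sum fun k hk => ?_) (sum_trigamma_bound_le n p hpn)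
  have hk : (k : ℝ) ≤ p := by exact_mod_cast (Finset.mem_Icc.1 hk).2
  have hd : 0 < (n : ℝ) - k + 1 := by linarith
  refine (iteratedDeriv_two_log_Gamma_le (by linarith)).trans_eq ?_
  field_simp
  ring
end

section
/- (Bartlett decomposition for the log determinant.) Let Y₁,…,Y_n be i.i.d. N_p(0, I_p) with p ≤ n and let Î = (1/n) ∑_{k=1}^n Y_k Y_kᵀ. Then log det(n·Î) has the same distribution as ∑_{k=1}^p log W_k, where W₁,…,W_p are independent random variables and W_k has the chi-squared distribution with n−k+1 degrees of freedom. -/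
open MeasureTheory ProbabilityTheory Filter Matrix

/-- The uncentered sample covariance matrix `Î = (1/n) ∑_{k=1}^n Y_k Y_kᵀ` of `n`
observations `Y 0, …, Y (n-1)`. -/
noncomputable def uncenteredCov {n p : ℕ} (Y : Fin n → Fin p → ℝ) :
    Matrix (Fin p) (Fin p) ℝ :=
  Matrix.of fun i j => (1 / (n : ℝ)) * ∑ k, Y k i * Y k j

/-- The chi-squared distribution with `m` degrees of freedom, i.e. the Gamma distribution
with shape `m/2` and rate `1/2`. -/
noncomputable def chiSqMeasure (m : ℕ) : Measure ℝ :=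
  gammaMeasure ((m : ℝ) / 2) (1 / 2)

/-- Two real random variables with the same moment generating function, finite near zero,
have the same law. -/
lemma map_eq_of_mgf_eq {Ω Ω' : Type*} {mΩ : MeasurableSpace Ω} {mΩ' : MeasurableSpace Ω'}
    {μ : Measure Ω} {μ' : Measure Ω'} [IsProbabilityMeasure μ] [IsProbabilityMeasure μ']
    {X : Ω → ℝ} {Y : Ω' → ℝ} (hX : AEMeasurable X μ) (hY : AEMeasurable Y μ')
    (h : mgf X μ = mgf Y μ') (h0 : 0 ∈ interior (integrableExpSet X μ)) :
    μ.map X = μ'.map Y := by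
  have : IsProbabilityMeasure (μ.map X) := Measure.isProbabilityMeasure_map hX
  have : IsProbabilityMeasure (μ'.map Y) := Measure.isProbabilityMeasure_map hY
  refine Measure.ext_of_charFun (funext fun t => ?_)
  rw [← complexMGF_mul_I hX, ← complexMGF_mul_I hY]
  exact eqOn_complexMGF_of_mgf h (by simpa using h0)

lemma mgf_gammaMeasure_eq_setIntegral {a r : ℝ} (ha : 0 < a) (hr : 0 < r) (t : ℝ) :
    mgf id (gammaMeasure a r) t =
      ∫ x in Set.Ioi 0, r ^ a / Real.Gamma a * (x ^ (a - 1) * Real.exp (-((r - t) * x))) := by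
  rw [mgf, gammaMeasure, integral_withDensity_eq_integral_toReal_smul
    (by unfold gammaPDF; fun_prop) (by simp [gammaPDF]), ← integral_Ici_eq_integral_Ioi,
    ← integral_indicator measurableSet_Ici]
  congr 1 with x
  rw [gammaPDF, ENNReal.toReal_ofReal (gammaPDFReal_nonneg ha hr x)]
  simp only [gammaPDFReal, Set.indicator, Set.mem_Ici, smul_eq_mul, ite_mul, zero_mul, id]
  split_ifs
  · rw [show -((r - t) * x) = -(r * x) + t * x by ring, Real.exp_add]
    ring
  · rfl

lemma mgf_gammaMeasure_of_lt {a r t : ℝ} (ha : 0 < a) (hr : 0 < r) (ht : t < r) :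
    mgf id (gammaMeasure a r) t = (r / (r - t)) ^ a := by
  have hrt : 0 < r - t := sub_pos.2 ht
  rw [mgf_gammaMeasure_eq_setIntegral ha hr, integral_const_mul,
    Real.integral_rpow_mul_exp_neg_mul_Ioi ha hrt, Real.div_rpow hr.le hrt.le,
    Real.div_rpow zero_le_one hrt.le, Real.one_rpow]
  have := (Real.Gamma_pos_of_pos ha).ne'
  field_simp

lemma mgf_gammaMeasure_of_le {a r t : ℝ} (ha : 0 < a) (hr : 0 < r) (ht : r ≤ t) :
    mgf id (gammaMeasure a r) t = 0 := by
  rw [mgf_gammaMeasure_eq_setIntegral ha hr, integral_const_mul, integral_undef, mul_zero]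
  intro h
  refine not_integrableOn_Ioi_rpow (a - 1) (h.mono (by fun_prop) ?_)
  filter_upwards [ae_restrict_mem measurableSet_Ioi] with x hx
  rw [norm_mul]
  refine le_mul_of_one_le_right (norm_nonneg _) ?_
  rw [Real.norm_of_nonneg (Real.exp_nonneg _), Real.one_le_exp_iff]
  nlinarith [Set.mem_Ioi.1 hx]

lemma mgf_chiSqMeasure {m : ℕ} (hm : m ≠ 0) (t : ℝ) :
    mgf id (chiSqMeasure m) t = √((1 - 2 * t)⁻¹) ^ m := by
  have hm' : 0 < (m : ℝ) / 2 := by positivity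
  rcases lt_or_ge t (1 / 2) with ht | ht
  · rw [chiSqMeasure, mgf_gammaMeasure_of_lt hm' one_half_pos ht, Real.sqrt_eq_rpow,
      ← Real.rpow_mul_natCast (inv_nonneg.2 (by linarith))]
    congr 1
    · have : 1 / 2 - t ≠ 0 := by linarith
      have : 1 - 2 * t ≠ 0 := by linarith
      field_simp
    · ring
  · rw [chiSqMeasure, mgf_gammaMeasure_of_le hm' one_half_pos ht,
      Real.sqrt_eq_zero_of_nonpos (inv_nonpos.2 (by linarith)), zero_pow hm]

lemma isProbabilityMeasure_chiSqMeasure {m : ℕ} (hm : m ≠ 0) :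
    IsProbabilityMeasure (chiSqMeasure m) :=
  isProbabilityMeasure_gammaMeasure (by positivity) one_half_pos

lemma ae_chiSqMeasure_ne_zero (m : ℕ) : ∀ᵐ x ∂(chiSqMeasure m), x ≠ 0 :=
  (withDensity_absolutelyContinuous _ _).ae_le (Measure.ae_ne volume 0)

lemma mgf_sq_gaussianReal (t : ℝ) :
    mgf (fun x => x ^ 2) (gaussianReal 0 1) t = √((1 - 2 * t)⁻¹) := by
  rw [mgf, integral_gaussianReal_eq_integral_smul one_ne_zero]
  have h : ∀ x : ℝ, gaussianPDFReal 0 1 x • Real.exp (t * x ^ 2) =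
      (√(2 * Real.pi))⁻¹ * Real.exp (-(1 / 2 - t) * x ^ 2) := by
    intro x
    simp only [gaussianPDFReal, NNReal.coe_one, mul_one, sub_zero, smul_eq_mul, mul_assoc,
      ← Real.exp_add]
    ring_nf
  simp_rw [h]
  rw [integral_const_mul, integral_gaussian, ← Real.sqrt_inv, ← Real.sqrt_mul (by positivity)]
  congr 1
  rw [show 1 - 2 * t = 2 * (1 / 2 - t) by ring]
  field_simp

/-- The law of the quadratic form of an orthogonal projection matrix of rank `m`, evaluated at a
standard Gaussian vector, is the chi-squared distribution with `m` degrees of freedom. -/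
lemma map_dotProduct_mulVec_eq_chiSqMeasure {ι : Type*} [Fintype ι] [DecidableEq ι]
    {S : Matrix ι ι ℝ} (hS : S.IsHermitian) (hS2 : S * S = S) {m : ℕ} (hm : m ≠ 0)
    (htr : S.trace = m) :
    (Measure.pi fun _ : ι => gaussianReal 0 1).map (fun x => x ⬝ᵥ S *ᵥ x) = chiSqMeasure m := by
  have := isProbabilityMeasure_chiSqMeasure hm
  set b := hS.eigenvectorBasis
  set l := hS.eigenvalues
  have hl : ∀ i, l i = 0 ∨ l i = 1 := by
    intro i
    have h1 : S *ᵥ ⇑(b i) = l i • ⇑(b i) := hS.mulVec_eigenvectorBasis i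
    have h2 : (l i * l i) • (b i) = l i • b i := by
      apply (WithLp.equiv 2 (ι → ℝ)).injective
      change (l i * l i) • ⇑(b i) = l i • ⇑(b i)
      rw [mul_smul, ← h1, ← mulVec_smul, ← h1, mulVec_mulVec, hS2]
    have h3 := smul_left_injective ℝ (b.orthonormal.ne_zero i) h2
    have : l i * (l i - 1) = 0 := by linear_combination h3
    rcases mul_eq_zero.1 this with h | h
    · exact Or.inl h
    · exact Or.inr (by linarith)
  have hq : ∀ x : ι → ℝ, (fun y : EuclideanSpace ℝ ι => y.ofLp ⬝ᵥ S *ᵥ y.ofLp)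
      (∑ i, x i • b i) = ∑ i, l i * x i ^ 2 := by
    intro x
    have h1 : WithLp.toLp 2 (S *ᵥ (∑ i, x i • b i : EuclideanSpace ℝ ι).ofLp) =
        ∑ i, (x i * l i) • b i := by
      apply (WithLp.equiv 2 (ι → ℝ)).injective
      change S *ᵥ (∑ i, x i • b i : EuclideanSpace ℝ ι).ofLp =
        (∑ i, (x i * l i) • b i : EuclideanSpace ℝ ι).ofLp
      rw [WithLp.ofLp_sum, WithLp.ofLp_sum, mulVec_sum]
      refine Finset.sum_congr rfl fun i _ => ?_
      rw [WithLp.ofLp_smul, WithLp.ofLp_smul, mulVec_smul, mul_smul]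
      congr 1
      exact hS.mulVec_eigenvectorBasis i
    have h2 := EuclideanSpace.inner_toLp_toLp (𝕜 := ℝ)
      (S *ᵥ (∑ i, x i • b i : EuclideanSpace ℝ ι).ofLp)
      (∑ i, x i • b i : EuclideanSpace ℝ ι).ofLp
    rw [h1, WithLp.toLp_ofLp, b.orthonormal.inner_sum, star_trivial] at h2
    refine h2.symm.trans ?_
    refine Finset.sum_congr rfl fun i _ => ?_
    simp only [conj_trivial]
    ring
  have hmap : (Measure.pi fun _ : ι => gaussianReal 0 1).map (fun x => x ⬝ᵥ S *ᵥ x) =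
      (Measure.pi fun _ : ι => gaussianReal 0 1).map (fun x => ∑ i, l i * x i ^ 2) := by
    have h := (map_pi_eq_stdGaussian (ι := ι)).trans (stdGaussian_eq_map_pi_orthonormalBasis b)
    have h' := congrArg (fun μ => μ.map fun y : EuclideanSpace ℝ ι => y.ofLp ⬝ᵥ S *ᵥ y.ofLp) h
    simp only at h'
    rw [Measure.map_map (by fun_prop) (by fun_prop),
      Measure.map_map (by fun_prop) (by fun_prop)] at h'
    simpa only [Function.comp_def, hq] using h'
  have hcard : (Finset.univ.filter fun i => l i = 1).card = m := by
    have : S.trace = ∑ i, l i := hS.trace_eq_sum_eigenvalues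
    rw [htr, Finset.sum_congr rfl (g := fun i => if l i = 1 then (1 : ℝ) else 0)] at this
    · rw [Finset.sum_boole] at this
      exact_mod_cast this.symm
    · intro i _
      rcases hl i with h | h <;> simp [h]
  have hmeas : Measurable fun x : ι → ℝ => ∑ i, l i * x i ^ 2 :=
    Finset.measurable_fun_sum _ fun i _ => ((measurable_pi_apply i).pow_const 2).const_mul _
  have hmgf : mgf (fun x : ι → ℝ => ∑ i, l i * x i ^ 2)
      (Measure.pi fun _ : ι => gaussianReal 0 1) = mgf id (chiSqMeasure m) := by
    ext t
    rw [mgf_chiSqMeasure hm, mgf]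
    simp_rw [Finset.mul_sum, Real.exp_sum]
    rw [integral_fintype_prod_eq_prod (f := fun i (y : ℝ) => Real.exp (t * (l i * y ^ 2))),
      ← hcard, ← Finset.prod_const, Finset.prod_filter]
    refine Finset.prod_congr rfl fun i _ => ?_
    rcases hl i with h | h
    · simp [h]
    · simpa only [h, one_mul, if_pos, mgf] using mgf_sq_gaussianReal t
  rw [hmap, map_eq_of_mgf_eq hmeas.aemeasurable aemeasurable_id hmgf, Measure.map_id]
  rw [integrableExpSet_eq_of_mgf hmgf, mem_interior_iff_mem_nhds]
  filter_upwards [Iio_mem_nhds (show (0 : ℝ) < 1 / 2 by norm_num)] with t ht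
  change Integrable _ _
  rw [← mgf_pos_iff, mgf_chiSqMeasure hm]
  have : 0 < 1 - 2 * t := by linarith [Set.mem_Iio.1 ht]
  positivity

instance (m : ℕ) : SigmaFinite (chiSqMeasure m) := by
  unfold chiSqMeasure gammaMeasure gammaPDF
  infer_instance

lemma ae_pi_chiSqMeasure_ne_zero {ι : Type*} [Fintype ι] (m : ι → ℕ) :
    ∀ᵐ w ∂(Measure.pi fun i => chiSqMeasure (m i)), ∀ i, w i ≠ 0 :=
  ae_all_iff.2 fun i => (Measure.quasiMeasurePreserving_eval (fun i => chiSqMeasure (m i)) i).ae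
    (ae_chiSqMeasure_ne_zero (m i))

/-- If, for almost every `a`, the random variable `f (·, a)` has the law of `g a` times a variable
of law `ν`, then `f` has the law of a product of independent variables of laws `ν` and
`P.map g`. -/
lemma map_prod_eq_map_mul {α β : Type*} {mα : MeasurableSpace α} {mβ : MeasurableSpace β}
    {γ : Measure β} [SFinite γ] {P : Measure α} [SFinite P] {ν : Measure ℝ} [SFinite ν]
    {f : β × α → ℝ} (hf : Measurable f) {g : α → ℝ} (hg : Measurable g)
    (h : ∀ᵐ a ∂P, γ.map (fun b => f (b, a)) = ν.map (fun w => w * g a)) :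
    (γ.prod P).map f = (ν.prod (P.map g)).map (fun q => q.1 * q.2) := by
  ext s hs
  have hmul : Measurable fun q : ℝ × ℝ => q.1 * q.2 := by fun_prop
  rw [Measure.map_apply hf hs, Measure.map_apply hmul hs, Measure.prod_apply_symm (hf hs),
    Measure.prod_apply_symm (hmul hs), lintegral_map (measurable_measure_prodMk_right (hmul hs)) hg]
  refine lintegral_congr_ae ?_
  filter_upwards [h] with a ha
  have := congrArg (fun μ => μ s) ha
  rwa [Measure.map_apply (by fun_prop) hs, Measure.map_apply (by fun_prop) hs] at this

lemma det_fromRows_mul_transpose {m k ι : Type*} [Fintype m] [DecidableEq m] [Fintype k]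
    [DecidableEq k] [Fintype ι] [DecidableEq ι] (A : Matrix m ι ℝ) (C : Matrix k ι ℝ)
    (h : (A * Aᵀ).det ≠ 0) :
    (fromRows A C * (fromRows A C)ᵀ).det =
      (A * Aᵀ).det * (C * (1 - Aᵀ * (A * Aᵀ)⁻¹ * A) * Cᵀ).det := by
  have := invertibleOfIsUnitDet _ (isUnit_iff_ne_zero.2 h)
  rw [transpose_fromRows, fromRows_mul_fromCols, det_fromBlocks₁₁, invOf_eq_nonsing_inv]
  congr 2
  simp only [Matrix.mul_sub, Matrix.sub_mul, Matrix.mul_one, Matrix.mul_assoc]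

/-- The matrix `1 - Aᵀ (A Aᵀ)⁻¹ A` is the orthogonal projection onto the kernel of `A`. -/
lemma one_sub_rowProjection {m ι : Type*} [Fintype m] [DecidableEq m] [Fintype ι] [DecidableEq ι]
    (A : Matrix m ι ℝ) (h : (A * Aᵀ).det ≠ 0) :
    (1 - Aᵀ * (A * Aᵀ)⁻¹ * A).IsHermitian ∧
      (1 - Aᵀ * (A * Aᵀ)⁻¹ * A) * (1 - Aᵀ * (A * Aᵀ)⁻¹ * A) = 1 - Aᵀ * (A * Aᵀ)⁻¹ * A ∧
      (1 - Aᵀ * (A * Aᵀ)⁻¹ * A).trace = (Fintype.card ι : ℝ) - Fintype.card m := by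
  have hu := isUnit_iff_ne_zero.2 h
  refine ⟨?_, ?_, ?_⟩
  · rw [IsHermitian, conjTranspose_eq_transpose_of_trivial, transpose_sub, transpose_one]
    simp only [transpose_mul, transpose_transpose, transpose_nonsing_inv, Matrix.mul_assoc]
  · have hP : Aᵀ * (A * Aᵀ)⁻¹ * A * (Aᵀ * (A * Aᵀ)⁻¹ * A) = Aᵀ * (A * Aᵀ)⁻¹ * A := by
      calc _ = Aᵀ * ((A * Aᵀ)⁻¹ * (A * Aᵀ)) * (A * Aᵀ)⁻¹ * A := by
            simp only [Matrix.mul_assoc]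
        _ = _ := by rw [nonsing_inv_mul _ hu, Matrix.mul_one]
    rw [Matrix.mul_sub, Matrix.sub_mul, Matrix.sub_mul, hP]
    simp
  · rw [trace_sub, trace_one, Matrix.mul_assoc, trace_mul_comm, Matrix.mul_assoc,
      nonsing_inv_mul _ hu, trace_one]

lemma det_gram_succ {n p : ℕ} (X : Fin (p + 1) → Fin n → ℝ) {A : Matrix (Fin p) (Fin n) ℝ}
    (hA : A = of fun i => X i.castSucc) (h : (A * Aᵀ).det ≠ 0) :
    (of X * (of X)ᵀ).det = (A * Aᵀ).det *
      (X (Fin.last p) ⬝ᵥ (1 - Aᵀ * (A * Aᵀ)⁻¹ * A) *ᵥ X (Fin.last p)) := by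
  have hX : (of X).submatrix finSumFinEquiv id =
      fromRows A (of fun _ : Fin 1 => X (Fin.last p)) := by
    ext i j
    rcases i with i | i
    · simp [hA, Fin.castSucc]
    · have : Fin.natAdd p i = Fin.last p := by ext; simp
      simp [this]
  have h1 : (of X * (of X)ᵀ).submatrix finSumFinEquiv finSumFinEquiv =
      (of X).submatrix (finSumFinEquiv (m := p) (n := 1)) id *
        ((of X).submatrix finSumFinEquiv id)ᵀ := by
    ext; simp [mul_apply]
  rw [← det_submatrix_equiv_self (finSumFinEquiv (m := p) (n := 1)), h1, hX,
    det_fromRows_mul_transpose _ _ h, det_fin_one, Matrix.mul_assoc]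
  rfl

/-- The law of the Gram determinant of `p ≤ n` independent standard Gaussian vectors in `ℝⁿ` is
the law of a product of independent chi-squared variables. -/
lemma map_det_gram_eq {n p : ℕ} (hpn : p ≤ n) :
    (Measure.pi fun _ : Fin p => (Measure.pi fun _ : Fin n => gaussianReal 0 1)).map
        (fun X => (of X * (of X)ᵀ).det) =
      (Measure.pi fun k : Fin p => chiSqMeasure (n - (k : ℕ))).map (fun w => ∏ k, w k) := by
  induction p with
  | zero => simp
  | succ p ih =>
    have ih := ih (by omega)
    have hdet : ∀ k : ℕ, Measurable fun X : Fin k → Fin n → ℝ => (of X * (of X)ᵀ).det :=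
      fun k => Continuous.measurable (by fun_prop)
    have hprod : ∀ k : ℕ, Measurable fun w : Fin k → ℝ => ∏ i, w i := fun k => by fun_prop
    have hne : ∀ᵐ X ∂(Measure.pi fun _ : Fin p => (Measure.pi fun _ : Fin n => gaussianReal 0 1)),
        (of X * (of X)ᵀ).det ≠ 0 := by
      refine ae_of_ae_map (p := fun x : ℝ => x ≠ 0) (hdet p).aemeasurable ?_
      rw [ih, ae_map_iff (p := fun x : ℝ => x ≠ 0) (hprod p).aemeasurable
        (measurableSet_singleton 0).compl]
      filter_upwards [ae_pi_chiSqMeasure_ne_zero fun k : Fin p => n - (k : ℕ)] with w hw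
      exact Finset.prod_ne_zero_iff.2 fun k _ => hw k
    have hL := (measurePreserving_piFinSuccAbove
      (fun _ : Fin (p + 1) => (Measure.pi fun _ : Fin n => gaussianReal 0 1)) (Fin.last p)).symm
    have hR := (measurePreserving_piFinSuccAbove
      (fun k : Fin (p + 1) => chiSqMeasure (n - (k : ℕ))) (Fin.last p)).symm
    simp only [Fin.succAbove_last, Fin.val_castSucc, Fin.val_last] at hL hR
    rw [← hL.map_eq, ← hR.map_eq, Measure.map_map (hdet _) (MeasurableEquiv.measurable _),
      Measure.map_map (hprod _) (MeasurableEquiv.measurable _)]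
    trans ((chiSqMeasure (n - p)).prod
      ((Measure.pi fun k : Fin p => chiSqMeasure (n - (k : ℕ))).map (fun w => ∏ k, w k))).map
        (fun q => q.1 * q.2)
    · rw [← ih]
      refine map_prod_eq_map_mul ((hdet _).comp (MeasurableEquiv.measurable _)) (hdet p) ?_
      filter_upwards [hne] with X hX
      obtain ⟨hS, hS2, htr⟩ := one_sub_rowProjection (of X) hX
      rw [← map_dotProduct_mulVec_eq_chiSqMeasure hS hS2 (m := n - p) (by omega)
        (by simpa [Nat.cast_sub (Nat.le_of_succ_le hpn)] using htr),
        Measure.map_map (by fun_prop) (Continuous.measurable (by fun_prop))]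
      congr 1 with x
      have hA : of X = of fun i : Fin p => (MeasurableEquiv.piFinSuccAbove
          (fun _ : Fin (p + 1) => Fin n → ℝ) (Fin.last p)).symm (x, X) i.castSucc := by
        ext i j
        simp [MeasurableEquiv.piFinSuccAbove]
      have h := det_gram_succ _ hA hX
      rw [mul_comm] at h
      simpa [MeasurableEquiv.piFinSuccAbove] using h
    · symm
      refine map_prod_eq_map_mul ((hprod _).comp (MeasurableEquiv.measurable _)) (hprod p)
        (.of_forall fun w => ?_)
      congr 1 with x
      simp [Fin.prod_univ_castSucc, MeasurableEquiv.piFinSuccAbove, mul_comm]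

lemma map_swap_pi_pi {ι κ X : Type*} [Fintype ι] [Fintype κ] {mX : MeasurableSpace X}
    (μ : Measure X) [IsProbabilityMeasure μ] :
    (Measure.pi fun _ : ι => Measure.pi fun _ : κ => μ).map Function.swap =
      Measure.pi fun _ : κ => Measure.pi fun _ : ι => μ := by
  have h := (measurePreserving_piCongrLeft (fun _ : κ × ι => μ) (Equiv.prodComm ι κ)).map_eq
  have h1 := Measure.infinitePi_map_curry (fun (_ : κ) (_ : ι) => μ)
  have h2 := Measure.infinitePi_map_curry_symm (fun (_ : ι) (_ : κ) => μ)
  simp only [Measure.infinitePi_eq_pi] at h1 h2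
  rw [← h1, ← h, ← h2, Measure.map_map (by fun_prop) (by fun_prop),
    Measure.map_map (by fun_prop) (by fun_prop)]
  rfl

/-- **Bartlett decomposition for the log determinant** (Lemma 5.2): if `Y₁, …, Y_n` are
i.i.d. `N_p(0, I_p)` with `p ≤ n` and `Î = (1/n) ∑ Y_k Y_kᵀ`, then `log det (n Î)` has the
same law as `∑_{k=1}^p log W_k` with `W₁, …, W_p` independent, `W_k ~ χ²_{n−k+1}`. -/
theorem bartlett_log_det
    (n p : ℕ) (hp1 : 1 ≤ p) (hpn : p ≤ n) :
    (Measure.pi fun _ : Fin n => (Measure.pi fun _ : Fin p => gaussianReal 0 1)).map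
        (fun Y => Real.log ((n : ℝ) • uncenteredCov Y).det) =
      (Measure.pi fun k : Fin p => chiSqMeasure (n - (k : ℕ))).map
        (fun w => ∑ k, Real.log (w k)) := by
  have hn : (n : ℝ) ≠ 0 := by exact_mod_cast (by omega : n ≠ 0)
  have hcov : ∀ Y : Fin n → Fin p → ℝ,
      (n : ℝ) • uncenteredCov Y = of (Function.swap Y) * (of (Function.swap Y))ᵀ := by
    intro Y
    ext i j
    simp [uncenteredCov, mul_apply, Function.swap, hn]
  have hswap : Measurable (Function.swap : (Fin n → Fin p → ℝ) → Fin p → Fin n → ℝ) := by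
    unfold Function.swap
    fun_prop
  have hdet : Measurable fun X : Fin p → Fin n → ℝ => (of X * (of X)ᵀ).det :=
    Continuous.measurable (by fun_prop)
  have h := congrArg (Measure.map Real.log) (map_det_gram_eq hpn)
  rw [← map_swap_pi_pi, Measure.map_map hdet hswap,
    Measure.map_map Real.measurable_log (hdet.comp hswap),
    Measure.map_map Real.measurable_log (by fun_prop)] at h
  simp_rw [hcov]
  refine h.trans (Measure.map_congr ?_)
  filter_upwards [ae_pi_chiSqMeasure_ne_zero fun k : Fin p => n - (k : ℕ)] with w hw
  exact Real.log_prod fun k _ => hw k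
end

section
/- For all positive integers n ≥ 2 and p with 1 ≤ p ≤ n, the ratio r_{n,p} = (∑_{k=1}^p 1/(n−k+1)²)/(∑_{k=1}^p 1/(n−k+1)) satisfies r_{n,p} ≤ max{ 1/(log n + 1), (π²/6)/(log(n+1) − log(log n + 1)) }. In particular r_{n,p} → 0 as n → ∞, uniformly over all p = p(n) ≤ n. -/
/-- The ratio `r_{n,p} = (∑_{k=1}^p 1/(n−k+1)²)/(∑_{k=1}^p 1/(n−k+1))`. -/
noncomputable def ratioNP (n p : ℕ) : ℝ :=
  (∑ k ∈ Finset.Icc 1 p, 1 / ((n : ℝ) - k + 1) ^ 2) /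
    (∑ k ∈ Finset.Icc 1 p, 1 / ((n : ℝ) - k + 1))

/-- The sum `1 / n + 1 / (n - 1) + ⋯` with `p` terms dominates the corresponding integral. -/
theorem log_sub_log_le_sum_Icc_one_div (n p : ℕ) (hp : p ≤ n) :
    Real.log (n + 1) - Real.log (n - p + 1) ≤
      ∑ k ∈ Finset.Icc 1 p, 1 / ((n : ℝ) - k + 1) := by
  induction p with
  | zero => simp
  | succ p ih =>
    have hlt : (p : ℝ) + 1 ≤ n := by exact_mod_cast hp
    have hpos : (0 : ℝ) < n - p := by linarith
    rw [Finset.sum_Icc_succ_top (by omega)]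
    have hstep := Real.log_le_sub_one_of_pos (x := ((n : ℝ) - p + 1) / (n - p)) (by positivity)
    rw [Real.log_div (by positivity) (by positivity)] at hstep
    have hquot : ((n : ℝ) - p + 1) / (n - p) - 1 = 1 / (n - p) := by field_simp; ring
    have hcast : (n : ℝ) - (p + 1 : ℕ) + 1 = n - p := by push_cast; ring
    rw [hcast]
    linarith [ih (by omega)]

theorem sum_Icc_one_div_sq_le (n p : ℕ) (hp : p ≤ n) :
    ∑ k ∈ Finset.Icc 1 p, 1 / ((n : ℝ) - k + 1) ^ 2 ≤ Real.pi ^ 2 / 6 := by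
  have hreindex : ∑ k ∈ Finset.Icc 1 p, 1 / ((n : ℝ) - k + 1) ^ 2 =
      ∑ j ∈ Finset.Icc (n - p + 1) n, 1 / (j : ℝ) ^ 2 := by
    refine Finset.sum_nbij' (fun k => n + 1 - k) (fun j => n + 1 - j) ?_ ?_ ?_ ?_ ?_
    all_goals intro k hk; rw [Finset.mem_Icc] at hk
    · rw [Finset.mem_Icc]; omega
    · rw [Finset.mem_Icc]; omega
    · omega
    · omega
    · rw [Nat.cast_sub (by omega)]; push_cast; ring
  rw [hreindex]
  exact sum_le_hasSum _ (fun _ _ => by positivity) hasSum_zeta_two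

theorem sum_Icc_one_div_pos (n p : ℕ) (h1 : 1 ≤ p) (hp : p ≤ n) :
    0 < ∑ k ∈ Finset.Icc 1 p, 1 / ((n : ℝ) - k + 1) := by
  refine Finset.sum_pos (fun k hk => ?_) ⟨1, by simpa using h1⟩
  have hk' : (k : ℝ) ≤ n := by exact_mod_cast (Finset.mem_Icc.1 hk).2.trans hp
  have : (0 : ℝ) < n - k + 1 := by linarith
  positivity

/-- The ratio is at most the largest of the reciprocals that are summed. -/
theorem ratioNP_le_one_div (n p : ℕ) (h1 : 1 ≤ p) (hp : p ≤ n) :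
    ratioNP n p ≤ 1 / ((n : ℝ) - p + 1) := by
  rw [ratioNP, div_le_iff₀ (sum_Icc_one_div_pos n p h1 hp), Finset.mul_sum]
  refine Finset.sum_le_sum fun k hk => ?_
  have hpn : (p : ℝ) ≤ n := by exact_mod_cast hp
  have hkp : (k : ℝ) ≤ p := by exact_mod_cast (Finset.mem_Icc.1 hk).2
  have hm : (0 : ℝ) < n - p + 1 := by linarith
  have hk0 : (0 : ℝ) < n - k + 1 := by linarith
  rw [sq, ← one_div_mul_one_div]
  gcongr

theorem ratioNP_le_max (n p : ℕ) (hn : 2 ≤ n) (h1 : 1 ≤ p) (hp : p ≤ n) :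
    ratioNP n p ≤
      max (1 / (Real.log n + 1))
        ((Real.pi ^ 2 / 6) / (Real.log (n + 1) - Real.log (Real.log n + 1))) := by
  have hn' : (2 : ℝ) ≤ n := by exact_mod_cast hn
  have hpn : (p : ℝ) ≤ n := by exact_mod_cast hp
  have hlog : 0 < Real.log n := Real.log_pos (by linarith)
  have hm : (0 : ℝ) < n - p + 1 := by linarith
  rcases le_total (Real.log n + 1) ((n : ℝ) - p + 1) with h | h
  · exact le_max_of_le_left ((ratioNP_le_one_div n p h1 hp).trans (by gcongr))
  · refine le_max_of_le_right ?_
    have hden : 0 < Real.log (n + 1) - Real.log (Real.log n + 1) := by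
      have := Real.log_le_sub_one_of_pos (x := (n : ℝ)) (by linarith)
      exact sub_pos.2 (Real.log_lt_log (by linarith) (by linarith))
    refine div_le_div₀ (by positivity) (sum_Icc_one_div_sq_le n p hp) hden ?_
    exact (sub_le_sub_left (Real.log_le_log hm h) _).trans
      (log_sub_log_le_sum_Icc_one_div n p hp)

theorem log_sub_one_div_two_le (n : ℕ) (hn : 1 ≤ n) :
    (Real.log n - 1) / 2 ≤ Real.log (n + 1) - Real.log (Real.log n + 1) := by
  have hn' : (1 : ℝ) ≤ n := by exact_mod_cast hn
  have hlog : 0 ≤ Real.log n := Real.log_nonneg hn'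
  have hhalf := Real.log_le_sub_one_of_pos (x := (Real.log n + 1) / 2) (by positivity)
  rw [Real.log_div (by positivity) (by norm_num)] at hhalf
  have hmono : Real.log n ≤ Real.log (n + 1) := Real.log_le_log (by linarith) (by linarith)
  linarith [Real.log_two_lt_d9]

open Filter Topology in
theorem tendsto_ratio_bound :
    Tendsto (fun n : ℕ => max (1 / (Real.log n + 1))
      ((Real.pi ^ 2 / 6) / (Real.log (n + 1) - Real.log (Real.log n + 1)))) atTop (𝓝 0) := by
  have hlog : Tendsto (fun n : ℕ => Real.log n) atTop atTop :=
    Real.tendsto_log_atTop.comp tendsto_natCast_atTop_atTop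
  have hleft : Tendsto (fun n : ℕ => 1 / (Real.log n + 1)) atTop (𝓝 0) :=
    (tendsto_atTop_add_const_right _ 1 hlog).const_div_atTop 1
  have hden : Tendsto (fun n : ℕ => Real.log (n + 1) - Real.log (Real.log n + 1)) atTop atTop := by
    refine tendsto_atTop_mono' _ ?_
      ((tendsto_atTop_add_const_right _ (-1) hlog).atTop_div_const two_pos)
    filter_upwards [eventually_ge_atTop 1] with n hn
    exact log_sub_one_div_two_le n hn
  simpa using hleft.max (hden.const_div_atTop (Real.pi ^ 2 / 6))

/-- **Lemma 5.3**: for `2 ≤ n` and `1 ≤ p ≤ n`,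
`r_{n,p} ≤ max{1/(log n + 1), (π²/6)/(log(n+1) − log(log n + 1))}`; in particular
`r_{n,p} → 0` as `n → ∞`, uniformly over all `p = p(n) ≤ n`. -/
theorem ratio_bound :
    (∀ n p : ℕ, 2 ≤ n → 1 ≤ p → p ≤ n →
      ratioNP n p ≤
        max (1 / (Real.log n + 1))
          ((Real.pi ^ 2 / 6) / (Real.log (n + 1) - Real.log (Real.log n + 1)))) ∧
    (∀ ε : ℝ, 0 < ε → ∃ N : ℕ, ∀ n ≥ N, ∀ p : ℕ, 1 ≤ p → p ≤ n → ratioNP n p < ε) := by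
  refine ⟨ratioNP_le_max, fun ε hε => ?_⟩
  obtain ⟨N, hN⟩ := Filter.eventually_atTop.1 (tendsto_ratio_bound.eventually_lt_const hε)
  refine ⟨max N 2, fun n hn p h1 hp => ?_⟩
  exact (ratioNP_le_max n p ((le_max_right _ _).trans hn) h1 hp).trans_lt
    (hN n ((le_max_left _ _).trans hn))
end

section
/- For every positive integer n and every differentiable function b : (0, ∞) → ℝ, sup_{θ > 0} [ (2/n)(1 + θ·b'(θ))² + b(θ)² ] ≥ 2/n. -/
open scoped ENNReal

/-- A real function whose derivative is at most a fixed negative number is not bounded. -/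
theorem exists_lt_abs_of_deriv_le_neg {g g' : ℝ → ℝ} {η : ℝ} (hη : 0 < η)
    (hg : ∀ t, HasDerivAt g (g' t) t) (hg' : ∀ t, g' t ≤ -η) (M : ℝ) : ∃ t, M < |g t| := by
  by_contra! hM
  have hM0 : 0 ≤ M := (abs_nonneg _).trans (hM 0)
  have hT : 0 < (2 * M + 1) / η := by positivity
  obtain ⟨t, -, ht⟩ := exists_hasDerivAt_eq_slope g g' hT
    (fun x _ => (hg x).continuousAt.continuousWithinAt) (fun x _ => hg x)
  have hslope := ht ▸ hg' t
  rw [sub_zero, div_le_iff₀ hT, neg_mul, mul_div_cancel₀ _ hη.ne'] at hslope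
  linarith [(abs_le.1 (hM 0)).2, (abs_le.1 (hM ((2 * M + 1) / η))).1]

/-- **Information-bound inequality over the full parameter range** (display (39)): for every
positive integer `n` and every function `b` differentiable on `(0, ∞)`,
`sup_{θ > 0} [(2/n)(1 + θ b'(θ))² + b(θ)²] ≥ 2/n`. -/
theorem bias_variance_sup_lower_bound
    (n : ℕ) (hn : 0 < n) (b : ℝ → ℝ)
    (hb : ∀ θ : ℝ, 0 < θ → DifferentiableAt ℝ b θ) :
    ENNReal.ofReal (2 / (n : ℝ)) ≤
      ⨆ θ : {θ : ℝ // 0 < θ},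
        ENNReal.ofReal
          ((2 / (n : ℝ)) * (1 + θ.1 * deriv b θ.1) ^ 2 + b θ.1 ^ 2) := by
  have hc : 0 < 2 / (n : ℝ) := by positivity
  generalize 2 / (n : ℝ) = c at hc ⊢
  by_contra! hlt
  obtain ⟨r, -, hSr, hrc⟩ := ENNReal.lt_iff_exists_real_btwn.1 hlt
  replace hrc : r < c := (ENNReal.ofReal_lt_ofReal_iff hc).1 hrc
  have hbound (θ : ℝ) (hθ : 0 < θ) : c * (1 + θ * deriv b θ) ^ 2 + b θ ^ 2 ≤ r := by
    have hθr := (le_iSup (fun θ : {θ : ℝ // 0 < θ} =>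
      ENNReal.ofReal (c * (1 + θ.1 * deriv b θ.1) ^ 2 + b θ.1 ^ 2)) ⟨θ, hθ⟩).trans_lt hSr
    exact (ENNReal.ofReal_lt_ofReal_iff'.1 hθr).1.le
  have hderiv (t : ℝ) :
      HasDerivAt (fun t => b (Real.exp t)) (Real.exp t * deriv b (Real.exp t)) t := by
    rw [mul_comm]
    exact (hb _ (Real.exp_pos t)).hasDerivAt.comp t (Real.hasDerivAt_exp t)
  have hη : 0 < (c - r) / (2 * c) := div_pos (sub_pos.2 hrc) (by positivity)
  obtain ⟨t, ht⟩ := exists_lt_abs_of_deriv_le_neg hη hderiv (fun t => by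
    have h := hbound _ (Real.exp_pos t)
    rw [← neg_div, le_div_iff₀ (by positivity)]
    nlinarith [sq_nonneg (b (Real.exp t)),
      mul_nonneg hc.le (sq_nonneg (Real.exp t * deriv b (Real.exp t)))]) (c + 1)
  have h := hbound _ (Real.exp_pos t)
  nlinarith [sq_abs (b (Real.exp t)),
    mul_nonneg hc.le (sq_nonneg (1 + Real.exp t * deriv b (Real.exp t)))]
end

section
/- For every positive integer n, every constant K > 1, and every differentiable function b : (0, ∞) → ℝ, sup_{1/K ≤ θ ≤ K} [ (2/n)(1 + θ·b'(θ))² + b(θ)² ] ≥ (2/n) · ( log K / (log K + √(2/n)) )². -/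
open scoped ENNReal

/-- **Information-bound inequality on `[1/K, K]`** (display (40)): for every positive
integer `n`, every `K > 1`, and every function `b` differentiable on `(0, ∞)`,
`sup_{1/K ≤ θ ≤ K} [(2/n)(1 + θ b'(θ))² + b(θ)²] ≥ (2/n)(log K/(log K + √(2/n)))²`. -/
theorem bias_variance_sup_lower_bound_interval
    (n : ℕ) (hn : 0 < n) (K : ℝ) (hK : 1 < K) (b : ℝ → ℝ)
    (hb : ∀ θ : ℝ, 0 < θ → DifferentiableAt ℝ b θ) :
    ENNReal.ofReal
        ((2 / (n : ℝ)) * (Real.log K / (Real.log K + Real.sqrt (2 / (n : ℝ)))) ^ 2) ≤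
      ⨆ θ : {θ : ℝ // 1 / K ≤ θ ∧ θ ≤ K},
        ENNReal.ofReal
          ((2 / (n : ℝ)) * (1 + θ.1 * deriv b θ.1) ^ 2 + b θ.1 ^ 2) := by
  set L := Real.log K with hLdef
  set s := Real.sqrt (2 / (n : ℝ)) with hsdef
  have hL : 0 < L := Real.log_pos hK
  have hn' : (0 : ℝ) < 2 / (n : ℝ) := by positivity
  have hs : 0 < s := Real.sqrt_pos.mpr hn'
  have hs2 : 2 / (n : ℝ) = s ^ 2 := (Real.sq_sqrt hn'.le).symm
  rw [hs2]
  by_contra hcon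
  rw [not_le] at hcon
  have hc : 0 < L / (L + s) := by positivity
  have bound : ∀ t ∈ Set.Icc (-L) L,
      s ^ 2 * (1 + Real.exp t * deriv b (Real.exp t)) ^ 2 + b (Real.exp t) ^ 2 <
        s ^ 2 * (L / (L + s)) ^ 2 := by
    intro t ht
    have hK0 : 0 < K := by linarith
    have h1 : 1 / K ≤ Real.exp t := by
      rw [one_div, ← Real.exp_log (inv_pos.mpr hK0), Real.log_inv]
      exact Real.exp_le_exp.mpr ht.1
    have h2 : Real.exp t ≤ K := by
      rw [← Real.le_log_iff_exp_le hK0]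
      exact ht.2
    have h3 := (le_iSup (fun θ : {θ : ℝ // 1 / K ≤ θ ∧ θ ≤ K} =>
      ENNReal.ofReal (s ^ 2 * (1 + θ.1 * deriv b θ.1) ^ 2 + b θ.1 ^ 2))
      ⟨Real.exp t, h1, h2⟩).trans_lt hcon
    exact (ENNReal.ofReal_lt_ofReal_iff (by positivity)).mp h3
  have abs_b : ∀ t ∈ Set.Icc (-L) L, |b (Real.exp t)| < s * (L / (L + s)) := by
    intro t ht
    refine abs_lt_of_sq_lt_sq ?_ (by positivity)
    rw [mul_pow]
    have h := bound t ht
    have : 0 ≤ s ^ 2 * (1 + Real.exp t * deriv b (Real.exp t)) ^ 2 := by positivity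
    linarith
  have hder : ∀ t : ℝ, HasDerivAt (fun t => b (Real.exp t))
      (deriv b (Real.exp t) * Real.exp t) t := fun t =>
    (hb _ (Real.exp_pos t)).hasDerivAt.comp t (Real.hasDerivAt_exp t)
  obtain ⟨t, ht, hslope⟩ := exists_hasDerivAt_eq_slope (fun t => b (Real.exp t)) _
    (show -L < L by linarith) (fun t _ => (hder t).continuousAt.continuousWithinAt)
    (fun t _ => hder t)
  have hd : |1 + Real.exp t * deriv b (Real.exp t)| < L / (L + s) := by
    refine abs_lt_of_sq_lt_sq ?_ hc.le
    have h := bound t (Set.Ioo_subset_Icc_self ht)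
    refine lt_of_mul_lt_mul_left (a := s ^ 2) ?_ (by positivity)
    nlinarith [sq_nonneg (b (Real.exp t))]
  have hleft := (abs_lt.mp (abs_b (-L) ⟨le_rfl, by linarith⟩)).2
  have hright := (abs_lt.mp (abs_b L ⟨by linarith, le_rfl⟩)).1
  have hd' := (abs_lt.mp hd).2
  rw [eq_div_iff (by linarith)] at hslope
  have hcomp : s * (L / (L + s)) = L * (1 - L / (L + s)) := by
    field_simp
    ring
  nlinarith [mul_lt_mul_of_pos_left hd' hL]
end
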